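/- arXiv:1711.04381 — 2 statements merged into one kernel-verified Lean document; each statement's English description precedes it below -/
import Mathlib

section
/- Let n ≥ 2 and let Ω ⊆ ℝⁿ be a bounded nonempty open set whose frontier ∂Ω satisfies 0 < H^{n−1}(∂Ω) < ∞. Then σ₁(Ω) · H^{n−1}(∂Ω)^{1/(n−1)} ≤ n^{1/(n−1)} · (H^n(Sⁿ))^{2/n} / (vol(Bⁿ))^{(n−2)/(n(n−1))}, where H^n(Sⁿ) is the n-dimensional Hausdorff measure of the unit sphere {y ∈ ℝ^{n+1} : ‖y‖ = 1} and vol(Bⁿ) is the Lebesgue measure of the open unit ball in ℝⁿ. -/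
open MeasureTheory

/-- The first nonzero Steklov eigenvalue of a domain `Ω ⊆ ℝⁿ`, defined variationally as the
infimum of Rayleigh quotients `(∫_Ω ‖∇f‖²) / (∫_{∂Ω} f² dH^{n-1})` over smooth functions `f`
with `∫_{∂Ω} f dH^{n-1} = 0` and `∫_{∂Ω} f² dH^{n-1} > 0`. -/
noncomputable def stekSigma1 {n : ℕ} (Ω : Set (EuclideanSpace ℝ (Fin n))) : ℝ :=
  sInf { q : ℝ | ∃ f : EuclideanSpace ℝ (Fin n) → ℝ, ContDiff ℝ (⊤ : ℕ∞) f ∧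
    (∫ x in frontier Ω, f x ∂(μH[(n : ℝ) - 1])) = 0 ∧
    (0 < ∫ x in frontier Ω, (f x) ^ 2 ∂(μH[(n : ℝ) - 1])) ∧
    q = (∫ x in Ω, ‖gradient f x‖ ^ 2) /
        (∫ x in frontier Ω, (f x) ^ 2 ∂(μH[(n : ℝ) - 1])) }

open scoped ENNReal NNReal Pointwise

theorem ENNReal.rpow_mul_rpow_le_add {p q : ℝ} (hp : 0 < p) (hq : 0 < q) (hpq : p + q = 1)
    (u v : ℝ≥0∞) : u ^ p * v ^ q ≤ ENNReal.ofReal p * u + ENNReal.ofReal q * v := by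
  have hp' : ENNReal.ofReal p ≠ 0 := by simpa using hp
  have hq' : ENNReal.ofReal q ≠ 0 := by simpa using hq
  rcases eq_or_ne u ⊤ with rfl | hu
  · simp [ENNReal.mul_top hp']
  rcases eq_or_ne v ⊤ with rfl | hv
  · simp [ENNReal.mul_top hq']
  lift u to ℝ≥0 using hu
  lift v to ℝ≥0 using hv
  have := NNReal.geom_mean_le_arith_mean2_weighted p.toNNReal q.toNNReal u v
    (by rw [← Real.toNNReal_add hp.le hq.le, hpq, Real.toNNReal_one])
  rw [Real.coe_toNNReal _ hp.le, Real.coe_toNNReal _ hq.le] at this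
  rw [← ENNReal.coe_rpow_of_nonneg _ hp.le, ← ENNReal.coe_rpow_of_nonneg _ hq.le]
  simp only [ENNReal.ofReal]
  exact_mod_cast this

theorem Real.volume_add_volume_le_of_isCompact {A B C : Set ℝ} (hA : IsCompact A)
    (hB : IsCompact B) (hA0 : A.Nonempty) (hB0 : B.Nonempty)
    (h : ∀ a ∈ A, ∀ b ∈ B, a + b ∈ C) : volume A + volume B ≤ volume C := by
  obtain ⟨a, ha, ha'⟩ := hA.exists_isGreatest hA0
  obtain ⟨b, hb, hb'⟩ := hB.exists_isLeast hB0
  have h1 : volume ((fun x => x + (-b)) ⁻¹' A) = volume A := measure_preimage_add_right _ _ _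
  have h2 : volume ((fun x => x + (-a)) ⁻¹' B) = volume B := measure_preimage_add_right _ _ _
  have hm : MeasurableSet ((fun x => x + (-a)) ⁻¹' B) :=
    hB.measurableSet.preimage (by fun_prop)
  rw [← h1, ← h2, ← measure_union₀ hm.nullMeasurableSet]
  · apply measure_mono
    rintro x (hx | hx)
    · simpa using h _ hx _ hb
    · simpa using h _ ha _ hx
  · refine measure_mono_null (t := {a + b}) ?_ (by simp)
    rintro x ⟨hx, hx'⟩
    have := ha' hx
    have := hb' hx'
    simp only [Set.mem_singleton_iff]
    linarith

theorem Real.volume_add_volume_le {A B C : Set ℝ} (hA : MeasurableSet A)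
    (hB : MeasurableSet B) (hA0 : A.Nonempty) (hB0 : B.Nonempty)
    (h : ∀ a ∈ A, ∀ b ∈ B, a + b ∈ C) : volume A + volume B ≤ volume C := by
  obtain ⟨a, ha⟩ := hA0
  obtain ⟨b, hb⟩ := hB0
  have key : ∀ K ⊆ A, IsCompact K → ∀ L ⊆ B, IsCompact L → volume K + volume L ≤ volume C := by
    intro K hKA hK L hLB hL
    refine (add_le_add (measure_mono (K.subset_insert a))
      (measure_mono (L.subset_insert b))).trans ?_
    exact Real.volume_add_volume_le_of_isCompact (hK.insert a) (hL.insert b)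
      (Set.insert_nonempty _ _) (Set.insert_nonempty _ _) fun x hx y hy =>
        h x (Set.insert_subset ha hKA hx) y (Set.insert_subset hb hLB hy)
  have key2 : ∀ L ⊆ B, IsCompact L → volume A + volume L ≤ volume C := by
    intro L hLB hL
    have h1 : volume A ≤ volume C - volume L := by
      rw [hA.measure_eq_iSup_isCompact]
      exact iSup₂_le fun K hK => iSup_le fun hKc =>
        ENNReal.le_sub_of_add_le_right hL.measure_lt_top.ne (key K hK hKc L hLB hL)
    refine add_le_of_le_tsub_right_of_le ?_ h1
    exact le_trans le_add_self (key ∅ (Set.empty_subset _) isCompact_empty L hLB hL)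
  rcases eq_or_ne (volume A) ⊤ with hAt | hAt
  · have := key2 ∅ (Set.empty_subset _) isCompact_empty
    simp only [hAt, measure_empty, add_zero, top_le_iff] at this
    simp [this]
  have h1 : volume B ≤ volume C - volume A := by
    rw [hB.measure_eq_iSup_isCompact]
    exact iSup₂_le fun L hL => iSup_le fun hLc =>
      ENNReal.le_sub_of_add_le_left hAt (key2 L hL hLc)
  refine add_le_of_le_tsub_left_of_le ?_ h1
  exact le_trans le_self_add (key2 ∅ (Set.empty_subset _) isCompact_empty)

theorem Real.volume_convexCombo_le {p q : ℝ} (hp : 0 < p) (hq : 0 < q) {A B C : Set ℝ}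
    (hA : MeasurableSet A) (hB : MeasurableSet B) (hA0 : A.Nonempty) (hB0 : B.Nonempty)
    (h : ∀ a ∈ A, ∀ b ∈ B, p * a + q * b ∈ C) :
    ENNReal.ofReal p * volume A + ENNReal.ofReal q * volume B ≤ volume C := by
  have e1 : volume (p • A) = ENNReal.ofReal p * volume A := by
    rw [Measure.addHaar_smul]; simp [abs_of_pos hp]
  have e2 : volume (q • B) = ENNReal.ofReal q * volume B := by
    rw [Measure.addHaar_smul]; simp [abs_of_pos hq]
  rw [← e1, ← e2]
  refine Real.volume_add_volume_le (hA.const_smul₀ p) (hB.const_smul₀ q) hA0.smul_set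
    hB0.smul_set ?_
  rintro _ ⟨a, ha, rfl⟩ _ ⟨b, hb, rfl⟩
  exact h a ha b hb

/-- The one-dimensional inequality for functions whose superlevel sets are nonempty up to
height `1`. -/
theorem Real.lintegral_convexCombo_le {p q : ℝ} (hp : 0 < p) (hq : 0 < q)
    {f g h : ℝ → ℝ} (hf : Measurable f) (hg : Measurable g) (hh : Measurable h)
    (f0 : ∀ x, 0 ≤ f x) (g0 : ∀ x, 0 ≤ g x) (h0 : ∀ x, 0 ≤ h x)
    (f1 : ∀ x, f x ≤ 1) (g1 : ∀ x, g x ≤ 1)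
    (fs : ∀ s < 1, ∃ x, s < f x) (gs : ∀ s < 1, ∃ x, s < g x)
    (H : ∀ s > 0, ∀ x y, s < f x → s < g y → s < h (p * x + q * y)) :
    ENNReal.ofReal p * (∫⁻ x, ENNReal.ofReal (f x)) + ENNReal.ofReal q *
      (∫⁻ x, ENNReal.ofReal (g x)) ≤ ∫⁻ x, ENNReal.ofReal (h x) := by
  rw [lintegral_eq_lintegral_meas_lt _ (.of_forall f0) hf.aemeasurable,
    lintegral_eq_lintegral_meas_lt _ (.of_forall g0) hg.aemeasurable,
    lintegral_eq_lintegral_meas_lt _ (.of_forall h0) hh.aemeasurable,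
    ← lintegral_const_mul' _ _ ENNReal.ofReal_ne_top,
    ← lintegral_const_mul' _ _ ENNReal.ofReal_ne_top, ← lintegral_add_left]
  · refine setLIntegral_mono' measurableSet_Ioi fun s hs => ?_
    rcases lt_or_ge s 1 with hs1 | hs1
    · exact Real.volume_convexCombo_le hp hq (measurableSet_lt measurable_const hf)
        (measurableSet_lt measurable_const hg) (fs s hs1) (gs s hs1)
        fun a ha b hb => H s hs a b ha hb
    · have e1 : {a | s < f a} = ∅ := by
        ext x; simpa using (f1 x).trans hs1
      have e2 : {a | s < g a} = ∅ := by
        ext x; simpa using (g1 x).trans hs1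
      simp [e1, e2]
  · refine Measurable.const_mul ?_ _
    exact Antitone.measurable fun s t hst => measure_mono fun x (hx : t < f x) => hst.trans_lt hx

/-- The Prékopa–Leindler inequality with weights `p`, `q` holds for the measure `μ`. -/
def PrekopaLeindler {E : Type*} [AddCommGroup E] [Module ℝ E] [MeasurableSpace E]
    (μ : Measure E) (p q : ℝ) : Prop :=
  ∀ f g h : E → ℝ≥0∞, Measurable f → Measurable g → Measurable h →
    (∀ x y, f x ^ p * g y ^ q ≤ h (p • x + q • y)) →
    (∫⁻ x, f x ∂μ) ^ p * (∫⁻ x, g x ∂μ) ^ q ≤ ∫⁻ x, h x ∂μ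

namespace PrekopaLeindler

theorem real_of_bounded {p q : ℝ} (hp : 0 < p) (hq : 0 < q) (hpq : p + q = 1)
    {f g h : ℝ → ℝ≥0∞} (hf : Measurable f) (hg : Measurable g) (hh : Measurable h)
    (fb : ⨆ x, f x ≠ ⊤) (gb : ⨆ x, g x ≠ ⊤)
    (H : ∀ x y, f x ^ p * g y ^ q ≤ h (p • x + q • y)) :
    (∫⁻ x, f x) ^ p * (∫⁻ x, g x) ^ q ≤ ∫⁻ x, h x := by
  set a := ⨆ x, f x with ha
  set b := ⨆ x, g x with hb
  have fa : ∀ x, f x ≤ a := le_iSup f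
  have gb' : ∀ x, g x ≤ b := le_iSup g
  rcases eq_or_ne a 0 with ha0 | ha0
  · have : ∀ x, f x = 0 := fun x => le_antisymm (ha0 ▸ fa x) zero_le
    simp [this, hp]
  rcases eq_or_ne b 0 with hb0 | hb0
  · have : ∀ x, g x = 0 := fun x => le_antisymm (hb0 ▸ gb' x) zero_le
    simp [this, hq]
  set c := a ^ p * b ^ q with hc
  have hap : a ^ p ≠ 0 := by simp [ha0, fb]
  have hbp : b ^ q ≠ 0 := by simp [hb0, gb]
  have hap' : a ^ p ≠ ⊤ := ENNReal.rpow_ne_top_of_nonneg hp.le fb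
  have hbp' : b ^ q ≠ ⊤ := ENNReal.rpow_ne_top_of_nonneg hq.le gb
  have hc0 : c ≠ 0 := mul_ne_zero hap hbp
  have hct : c ≠ ⊤ := ENNReal.mul_ne_top hap' hbp'
  have f1 : ∀ x, f x / a ≤ 1 := fun x => ENNReal.div_le_of_le_mul (by simpa using fa x)
  have g1 : ∀ x, g x / b ≤ 1 := fun x => ENNReal.div_le_of_le_mul (by simpa using gb' x)
  have ft : ∀ x, f x / a ≠ ⊤ := fun x => ((f1 x).trans_lt ENNReal.one_lt_top).ne
  have gt : ∀ x, g x / b ≠ ⊤ := fun x => ((g1 x).trans_lt ENNReal.one_lt_top).ne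
  have ht : ∀ x, min (h x / c) 1 ≠ ⊤ := fun x =>
    ((min_le_right _ _).trans_lt ENNReal.one_lt_top).ne
  have lt_iff : ∀ (u : ℝ≥0∞) (s : ℝ), 0 ≤ s → u ≠ ⊤ → (s < u.toReal ↔ ENNReal.ofReal s < u) :=
    fun u s hs hu => (ENNReal.ofReal_lt_iff_lt_toReal hs hu).symm
  have sup1 : ∀ (f : ℝ → ℝ≥0∞), (⨆ x, f x) ≠ 0 → (⨆ x, f x) ≠ ⊤ →
      (∀ x, f x / (⨆ x, f x) ≠ ⊤) → ∀ s < 1, ∃ x, s < (f x / ⨆ x, f x).toReal := by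
    intro f h0 ht hft s hs
    have : ENNReal.ofReal (max s 0) * (⨆ x, f x) < ⨆ x, f x := by
      conv_rhs => rw [← one_mul (⨆ x, f x)]
      refine ENNReal.mul_lt_mul_left h0 ht ?_
      simpa using hs
    obtain ⟨x, hx⟩ := lt_iSup_iff.1 this
    refine ⟨x, (le_max_left s 0).trans_lt ?_⟩
    rw [lt_iff _ _ (le_max_right _ _) (hft x)]
    exact (ENNReal.lt_div_iff_mul_lt (.inl h0) (.inl ht)).2 hx
  have key := Real.lintegral_convexCombo_le hp hq (f := fun x => (f x / a).toReal)
    (g := fun x => (g x / b).toReal) (h := fun x => (min (h x / c) 1).toReal)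
    (by fun_prop) (by fun_prop) (by fun_prop)
    (fun x => ENNReal.toReal_nonneg) (fun x => ENNReal.toReal_nonneg)
    (fun x => ENNReal.toReal_nonneg)
    (fun x => ENNReal.toReal_le_of_le_ofReal zero_le_one (by simpa using f1 x))
    (fun x => ENNReal.toReal_le_of_le_ofReal zero_le_one (by simpa using g1 x))
    (sup1 f ha0 fb ft) (sup1 g hb0 gb gt) (by
      intro s hs x y hx hy
      rw [lt_iff _ _ hs.le (ft x)] at hx
      rw [lt_iff _ _ hs.le (gt y)] at hy
      rw [lt_iff _ _ hs.le (ht _)]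
      refine lt_min ?_ (hx.trans_le (f1 x))
      have h1 : ENNReal.ofReal s = ENNReal.ofReal s ^ p * ENNReal.ofReal s ^ q := by
        rw [← ENNReal.rpow_add_of_nonneg _ _ hp.le hq.le, hpq, ENNReal.rpow_one]
      rw [h1]
      calc ENNReal.ofReal s ^ p * ENNReal.ofReal s ^ q
          < (f x / a) ^ p * (g y / b) ^ q :=
            ENNReal.mul_lt_mul (ENNReal.rpow_lt_rpow hx hp) (ENNReal.rpow_lt_rpow hy hq)
        _ = (f x ^ p * g y ^ q) / c := by
            rw [ENNReal.div_rpow_of_nonneg _ _ hp.le, ENNReal.div_rpow_of_nonneg _ _ hq.le,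
              ENNReal.mul_div_mul_comm (.inl hap) (.inl hap')]
        _ ≤ h (p * x + q * y) / c := ENNReal.div_le_div_right (H x y) _)
  simp only [ENNReal.ofReal_toReal (ft _), ENNReal.ofReal_toReal (gt _),
    ENNReal.ofReal_toReal (ht _)] at key
  have key2 := (ENNReal.rpow_mul_rpow_le_add hp hq hpq _ _).trans key
  have key3 : (∫⁻ x, f x / a) ^ p * (∫⁻ x, g x / b) ^ q ≤ (∫⁻ x, h x / c) :=
    key2.trans (lintegral_mono fun x => min_le_left _ _)
  simp only [div_eq_mul_inv] at key3
  rw [lintegral_mul_const _ hf, lintegral_mul_const _ hg, lintegral_mul_const _ hh] at key3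
  simp only [← div_eq_mul_inv] at key3
  rwa [ENNReal.div_rpow_of_nonneg _ _ hp.le, ENNReal.div_rpow_of_nonneg _ _ hq.le,
    ← ENNReal.mul_div_mul_comm (.inl hap) (.inl hap'),
    ENNReal.div_le_iff hc0 hct, ENNReal.div_mul_cancel hc0 hct] at key3

theorem real {p q : ℝ} (hp : 0 < p) (hq : 0 < q) (hpq : p + q = 1) :
    PrekopaLeindler (volume : Measure ℝ) p q := by
  intro f g h hf hg hh H
  have key : ∀ f : ℝ → ℝ≥0∞, Measurable f → ∀ r : ℝ, 0 < r →
      (∫⁻ x, f x) ^ r = ⨆ n : ℕ, (∫⁻ x, min (f x) n) ^ r := by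
    intro f hf r hr
    have : ∀ x, f x = ⨆ n : ℕ, min (f x) n := fun x => by
      rw [← inf_iSup_eq, ENNReal.iSup_natCast, inf_top_eq]
    conv_lhs => rw [lintegral_congr this]
    rw [lintegral_iSup (fun n => hf.min measurable_const)
      (fun m n hmn x => min_le_min le_rfl (by exact_mod_cast hmn))]
    exact (ENNReal.orderIsoRpow r hr).map_iSup _
  rw [key f hf p hp, key g hg q hq, ENNReal.iSup_mul]
  refine iSup_le fun m => ?_
  rw [ENNReal.mul_iSup]
  refine iSup_le fun n => ?_
  have bd : ∀ (f : ℝ → ℝ≥0∞) (n : ℕ), ⨆ x, min (f x) n ≠ ⊤ := fun f n =>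
    ((iSup_le fun x => min_le_right _ _).trans_lt (ENNReal.natCast_lt_top n)).ne
  refine real_of_bounded hp hq hpq (hf.min measurable_const) (hg.min measurable_const) hh
    (bd f m) (bd g n) fun x y => le_trans ?_ (H x y)
  gcongr <;> exact min_le_left _ _

theorem prod {E F : Type*} [AddCommGroup E] [Module ℝ E] [MeasurableSpace E]
    [AddCommGroup F] [Module ℝ F] [MeasurableSpace F] {μ : Measure E} {ν : Measure F} [SFinite ν]
    {p q : ℝ} (h1 : PrekopaLeindler μ p q) (h2 : PrekopaLeindler ν p q) :
    PrekopaLeindler (μ.prod ν) p q := by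
  intro f g h hf hg hh H
  rw [lintegral_prod _ hf.aemeasurable, lintegral_prod _ hg.aemeasurable,
    lintegral_prod _ hh.aemeasurable]
  refine h1 _ _ _ hf.lintegral_prod_right' hg.lintegral_prod_right' hh.lintegral_prod_right' ?_
  intro x y
  exact h2 _ _ _ (by fun_prop) (by fun_prop) (by fun_prop) fun u v => H (x, u) (y, v)

theorem map {E F : Type*} [AddCommGroup E] [Module ℝ E] [MeasurableSpace E]
    [AddCommGroup F] [Module ℝ F] [MeasurableSpace F] {μ : Measure E} {ν : Measure F}
    {p q : ℝ} (h1 : PrekopaLeindler μ p q) (e : E →ₗ[ℝ] F) (he : MeasurePreserving e μ ν) :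
    PrekopaLeindler ν p q := by
  intro f g h hf hg hh H
  rw [← he.lintegral_comp hf, ← he.lintegral_comp hg, ← he.lintegral_comp hh]
  have := he.measurable
  exact h1 _ _ _ (by fun_prop) (by fun_prop) (by fun_prop) fun x y => by
    simpa using H (e x) (e y)

theorem pi {p q : ℝ} (hp : 0 < p) (hq : 0 < q) (hpq : p + q = 1) (n : ℕ) :
    PrekopaLeindler (volume : Measure (Fin n → ℝ)) p q := by
  induction n with
  | zero =>
    intro f g h hf hg hh H
    have hv : (volume : Measure (Fin 0 → ℝ)) Set.univ = 1 := by simp [volume_pi]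
    simp only [lintegral_unique, hv, mul_one]
    have := H default default
    rw [Subsingleton.elim (p • default + q • default) (default : Fin 0 → ℝ)] at this
    convert! this
  | succ n ih =>
    let e : (ℝ × (Fin n → ℝ)) →ₗ[ℝ] (Fin (n + 1) → ℝ) :=
      { toFun := fun x => Fin.cons x.1 x.2
        map_add' := fun x y => by ext i; refine Fin.cases ?_ (fun j => ?_) i <;> simp
        map_smul' := fun c x => by ext i; refine Fin.cases ?_ (fun j => ?_) i <;> simp }
    refine ((real hp hq hpq).prod ih).map e ?_
    have := (volume_preserving_piFinSuccAbove (fun _ : Fin (n + 1) => ℝ) 0).symm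
    convert! this using 1
    ext x i
    refine Fin.cases ?_ (fun j => ?_) i <;>
      simp [e, MeasurableEquiv.piFinSuccAbove, Fin.insertNthEquiv]

theorem euclideanSpace {p q : ℝ} (hp : 0 < p) (hq : 0 < q) (hpq : p + q = 1) (n : ℕ) :
    PrekopaLeindler (volume : Measure (EuclideanSpace ℝ (Fin n))) p q :=
  (pi hp hq hpq n).map (WithLp.linearEquiv 2 ℝ (Fin n → ℝ)).symm.toLinearMap
    (PiLp.volume_preserving_toLp (Fin n))

end PrekopaLeindler

/-- The first-order form of the Brunn–Minkowski inequality for the sum of a set and a ball. -/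
theorem EuclideanSpace.volume_add_le_of_add_ball_subset {n : ℕ} (hn : n ≠ 0)
    {A C : Set (EuclideanSpace ℝ (Fin n))} (hA : MeasurableSet A) (hC : MeasurableSet C)
    (hA0 : volume A ≠ 0) {t : ℝ} (ht : 0 < t)
    (h : ∀ a ∈ A, ∀ b ∈ Metric.ball (0 : EuclideanSpace ℝ (Fin n)) t, a + b ∈ C) :
    volume A + ENNReal.ofReal (n * t) *
      volume (Metric.ball (0 : EuclideanSpace ℝ (Fin n)) 1) ^ ((n : ℝ)⁻¹) *
        volume A ^ (((n : ℝ) - 1) / n) ≤ volume C := by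
  rcases eq_or_ne (volume A) ⊤ with hAt | hAt
  · have : volume A ≤ volume C := measure_mono fun a ha => by
      simpa using h a ha 0 (by simpa using ht)
    rw [hAt, top_le_iff] at this
    simp [this]
  set ω := volume (Metric.ball (0 : EuclideanSpace ℝ (Fin n)) 1) with hω
  have hω0 : ω ≠ 0 := (Metric.measure_ball_pos volume _ one_pos).ne'
  have hωt : ω ≠ ⊤ := measure_ball_lt_top.ne
  have hn' : (n : ℝ) ≠ 0 := by exact_mod_cast hn
  have hn1 : 1 ≤ n := Nat.one_le_iff_ne_zero.2 hn
  have hV : 0 < (volume A).toReal := ENNReal.toReal_pos hA0 hAt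
  have hW : 0 < ω.toReal := ENNReal.toReal_pos hω0 hωt
  set α := (volume A).toReal ^ ((n : ℝ)⁻¹) with hα
  set γ := ω.toReal ^ ((n : ℝ)⁻¹) with hγ
  have hα0 : 0 < α := Real.rpow_pos_of_pos hV _
  have hγ0 : 0 < γ := Real.rpow_pos_of_pos hW _
  set β := t * γ with hβ
  have hβ0 : 0 < β := mul_pos ht hγ0
  have hαn : α ^ n = (volume A).toReal := Real.rpow_inv_natCast_pow hV.le hn
  have hγn : γ ^ n = ω.toReal := Real.rpow_inv_natCast_pow hW.le hn
  set p := α / (α + β) with hp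
  set q := β / (α + β) with hq
  have hp0 : 0 < p := by positivity
  have hq0 : 0 < q := by positivity
  have hpq : p + q = 1 := by rw [hp, hq]; field_simp
  have hB : volume (Metric.ball (0 : EuclideanSpace ℝ (Fin n)) t) = ENNReal.ofReal (β ^ n) := by
    rw [Measure.addHaar_ball_of_pos _ _ ht, finrank_euclideanSpace_fin, ← hω, hβ, mul_pow, hγn,
      ENNReal.ofReal_mul (by positivity), ENNReal.ofReal_toReal hωt]
  have hA' : volume A = ENNReal.ofReal (α ^ n) := by rw [hαn, ENNReal.ofReal_toReal hAt]
  have key := PrekopaLeindler.euclideanSpace hp0 hq0 hpq n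
    (((fun x => p • x) ⁻¹' A).indicator 1)
    (((fun x => q • x) ⁻¹' Metric.ball (0 : EuclideanSpace ℝ (Fin n)) t).indicator 1)
    (C.indicator 1)
    (measurable_one.indicator (hA.preimage (by fun_prop)))
    (measurable_one.indicator (measurableSet_ball.preimage (by fun_prop)))
    (measurable_one.indicator hC) (by
      intro x y
      by_cases hx : p • x ∈ A
      · by_cases hy : q • y ∈ Metric.ball (0 : EuclideanSpace ℝ (Fin n)) t
        · rw [Set.indicator_of_mem (h _ hx _ hy), Set.indicator_of_mem (by exact hx),
            Set.indicator_of_mem (by exact hy)]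
          simp
        · rw [Set.indicator_of_notMem (s := _ ⁻¹' Metric.ball _ _) (by exact hy)]
          simp [hq0]
      · rw [Set.indicator_of_notMem (s := _ ⁻¹' A) (by exact hx)]
        simp [hp0])
  rw [lintegral_indicator_one (hA.preimage (by fun_prop)),
    lintegral_indicator_one (measurableSet_ball.preimage (by fun_prop)),
    lintegral_indicator_one hC, Measure.addHaar_preimage_smul _ hp0.ne',
    Measure.addHaar_preimage_smul _ hq0.ne', hB, hA', finrank_euclideanSpace_fin,
    abs_of_pos (by positivity), abs_of_pos (by positivity),
    ← ENNReal.ofReal_mul (by positivity), ← ENNReal.ofReal_mul (by positivity)] at key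
  have e1 : (p ^ n)⁻¹ * α ^ n = (α + β) ^ n := by
    rw [hp, div_pow]; field_simp
  have e2 : (q ^ n)⁻¹ * β ^ n = (α + β) ^ n := by
    rw [hq, div_pow]; field_simp
  rw [e1, e2, ← ENNReal.rpow_add_of_nonneg _ _ hp0.le hq0.le, hpq, ENNReal.rpow_one] at key
  refine le_trans ?_ key
  have e3 : ω ^ ((n : ℝ)⁻¹) = ENNReal.ofReal γ := by
    rw [hγ, ← ENNReal.ofReal_rpow_of_pos hW, ENNReal.ofReal_toReal hωt]
  have e4 : volume A ^ (((n : ℝ) - 1) / n) = ENNReal.ofReal (α ^ (n - 1)) := by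
    rw [hA', ENNReal.ofReal_rpow_of_pos (by positivity), ← Real.rpow_natCast α n,
      ← Real.rpow_mul hα0.le, mul_div_cancel₀ _ hn', ← Real.rpow_natCast α (n - 1)]
    push_cast [hn1]
    rfl
  rw [e3, e4, hA', ← ENNReal.ofReal_mul (by positivity), ← ENNReal.ofReal_mul (by positivity),
    ← ENNReal.ofReal_add (by positivity) (by positivity)]
  apply ENNReal.ofReal_le_ofReal
  have := one_add_mul_le_pow (a := β / α) (by have := div_pos hβ0 hα0; linarith) n
  have e5 : α + β = α * (1 + β / α) := by field_simp
  rw [e5, mul_pow]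
  have e6 : α ^ n = α * α ^ (n - 1) := by rw [← pow_succ', Nat.sub_add_cancel hn1]
  calc α ^ n + n * t * γ * α ^ (n - 1) = α ^ n * (1 + n * (β / α)) := by
        rw [e6, hβ]; field_simp
    _ ≤ _ := by gcongr

theorem exists_add_smul_mem_frontier {E : Type*} [NormedAddCommGroup E] [NormedSpace ℝ E]
    {Ω : Set E} (hΩ : IsOpen Ω) {z w : E} (hz : z ∉ Ω) (hw : z + w ∈ Ω) :
    ∃ s ∈ Set.Icc (0 : ℝ) 1, z + s • w ∈ frontier Ω := by
  by_contra! H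
  have hsub : segment ℝ z (z + w) ⊆ Ω ∪ (closure Ω)ᶜ := by
    intro x hx
    rw [segment_eq_image'] at hx
    obtain ⟨s, hs, rfl⟩ := hx
    have := H s hs
    simp only [add_sub_cancel_left]
    rw [hΩ.frontier_eq] at this
    by_contra h
    simp only [Set.mem_union, Set.mem_compl_iff, not_or, not_not] at h
    exact this ⟨h.2, h.1⟩
  have := (convex_segment (𝕜 := ℝ) z (z + w)).isPreconnected.subset_left_of_subset_union hΩ
    isClosed_closure.isOpen_compl
    (disjoint_compl_right.mono_left subset_closure) hsub
    ⟨_, right_mem_segment ℝ z (z + w), hw⟩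
  exact hz (this (left_mem_segment ℝ z (z + w)))

/-- A set of small diameter swept along a segment of length `r` has volume at most
about `r` times its codimension one Hausdorff measure. -/
theorem EuclideanSpace.volume_sweep_le {m : ℕ} {u : EuclideanSpace ℝ (Fin (m + 1))}
    (hu : ‖u‖ = 1) {r δ : ℝ} {s : Set (EuclideanSpace ℝ (Fin (m + 1)))}
    (hs : ∀ x ∈ s, ∀ y ∈ s, dist x y ≤ δ) :
    volume {z | ∃ τ ∈ Set.Icc 0 r, z + τ • u ∈ s} ≤ ENNReal.ofReal (r + 2 * δ) * μH[m] s := by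
  rcases s.eq_empty_or_nonempty with rfl | ⟨p, hp⟩
  · simp
  obtain ⟨b, hb⟩ := Orthonormal.exists_orthonormalBasis_extension_of_card_eq (𝕜 := ℝ)
    (E := EuclideanSpace ℝ (Fin (m + 1))) (ι := Fin (m + 1)) (by simp) (v := fun _ => u)
    (s := {0}) (by
      rw [orthonormal_iff_ite]
      rintro ⟨i, hi⟩ ⟨j, hj⟩
      obtain rfl : i = 0 := hi
      obtain rfl : j = 0 := hj
      simp [hu])
  have hb0 : b 0 = u := hb 0 rfl
  have hru : b.repr u = EuclideanSpace.single 0 1 := by rw [← hb0]; exact b.repr_self 0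
  let π : EuclideanSpace ℝ (Fin (m + 1)) → (Fin m → ℝ) := fun x i => b.repr x i.succ
  have hcoord : ∀ x y i, |b.repr x i - b.repr y i| ≤ dist x y := by
    intro x y i
    rw [← Real.norm_eq_abs, ← b.repr.dist_map, dist_eq_norm, ← PiLp.sub_apply]
    exact PiLp.norm_apply_le _ i
  have hπ : LipschitzWith 1 π := by
    refine LipschitzWith.of_dist_le_mul fun x y => ?_
    rw [NNReal.coe_one, one_mul, dist_pi_le_iff dist_nonneg]
    intro i
    rw [Real.dist_eq]
    exact hcoord x y _
  have hπs : volume (π '' s) ≤ μH[m] s := by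
    rw [← hausdorffMeasure_pi_real, Fintype.card_fin]
    simpa using hπ.hausdorffMeasure_image_le (d := m) (by positivity) s
  let P : EuclideanSpace ℝ (Fin (m + 1)) → ℝ × (Fin m → ℝ) := fun x => (b.repr x 0, π x)
  have hP : MeasurePreserving P volume volume := by
    have := ((volume_preserving_piFinSuccAbove (fun _ : Fin (m + 1) => ℝ) 0).comp
      (PiLp.volume_preserving_ofLp (Fin (m + 1)))).comp b.measurePreserving_repr
    convert! this using 1
  set I := Set.Icc (b.repr p 0 - δ - r) (b.repr p 0 + δ)
  have hsub : {z | ∃ τ ∈ Set.Icc 0 r, z + τ • u ∈ s} ⊆ P ⁻¹' (I ×ˢ (π '' s)) := by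
    rintro z ⟨τ, hτ, hz⟩
    have h0 : b.repr (z + τ • u) 0 = b.repr z 0 + τ := by simp [hru]
    refine ⟨?_, z + τ • u, hz, ?_⟩
    · have := (hcoord (z + τ • u) p 0).trans (hs _ hz _ hp)
      rw [abs_le, h0] at this
      simp only [P, I, Set.mem_Icc]
      constructor <;> linarith [hτ.1, hτ.2]
    · ext i
      simp [π, P, hru]
  calc volume {z | ∃ τ ∈ Set.Icc 0 r, z + τ • u ∈ s}
      ≤ volume (P ⁻¹' (I ×ˢ (π '' s))) := measure_mono hsub
    _ ≤ Measure.map P volume (I ×ˢ (π '' s)) := Measure.le_map_apply hP.aemeasurable _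
    _ = volume I * volume (π '' s) := by
        rw [hP.map_eq, Measure.volume_eq_prod, Measure.prod_prod]
    _ ≤ _ := by
        gcongr
        rw [Real.volume_Icc]
        apply ENNReal.ofReal_le_ofReal
        linarith

/-- The integral of `k` over the set swept by the compact frontier of `Ω` is controlled by
its integral over the frontier. -/
theorem EuclideanSpace.lintegral_sweep_le {m : ℕ} {u : EuclideanSpace ℝ (Fin (m + 1))}
    (hu : ‖u‖ = 1) {r : ℝ} {K : Set (EuclideanSpace ℝ (Fin (m + 1)))}
    (hK : MeasurableSet K) (hKfin : μH[m] K ≠ ⊤)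
    {k : EuclideanSpace ℝ (Fin (m + 1)) → ℝ≥0∞} {L : ℝ} (hL : 0 ≤ L) (hkm : Measurable k)
    {M : ℝ≥0∞} (hM : M ≠ ⊤) (hkM : ∀ x, k x ≤ M)
    (hk : ∀ x y, k x ≤ k y + ENNReal.ofReal (L * dist x y)) :
    ∫⁻ z in {z | ∃ τ ∈ Set.Icc 0 r, z + τ • u ∈ K}, k z ≤
      ENNReal.ofReal r * (∫⁻ y in K, k y ∂μH[m] + ENNReal.ofReal (L * r) * μH[m] K) := by
  have step : ∀ δ > 0, ∫⁻ z in {z | ∃ τ ∈ Set.Icc 0 r, z + τ • u ∈ K}, k z ≤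
      ENNReal.ofReal (r + 2 * δ) *
        (∫⁻ y in K, k y ∂μH[m] + ENNReal.ofReal (L * (r + δ)) * μH[m] K) := by
    intro δ hδ
    obtain ⟨A, hAm, hAb, hAd, hAu, hAdisj⟩ :=
      SeparableSpace.exists_measurable_partition_diam_le (EuclideanSpace ℝ (Fin (m + 1))) hδ
    set S := fun i => {z | ∃ τ ∈ Set.Icc 0 r, z + τ • u ∈ K ∩ A i} with hS
    have hdist : ∀ i, ∀ x ∈ K ∩ A i, ∀ y ∈ K ∩ A i, dist x y ≤ δ := fun i x hx y hy =>
      (Metric.dist_le_diam_of_mem (hAb i) hx.2 hy.2).trans (hAd i)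
    have hcov : {z | ∃ τ ∈ Set.Icc 0 r, z + τ • u ∈ K} ⊆ ⋃ i, S i := by
      rintro z ⟨τ, hτ, hz⟩
      have : z + τ • u ∈ ⋃ i, A i := hAu ▸ Set.mem_univ _
      obtain ⟨i, hi⟩ := Set.mem_iUnion.1 this
      exact Set.mem_iUnion.2 ⟨i, τ, hτ, hz, hi⟩
    have hpiece : ∀ i, ∫⁻ z in S i, k z ≤ ENNReal.ofReal (r + 2 * δ) *
        ∫⁻ y in K ∩ A i, (k y + ENNReal.ofReal (L * (r + δ))) ∂μH[m] := by
      intro i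
      have hpt : ∀ y ∈ K ∩ A i, ∀ z ∈ S i, k z ≤ k y + ENNReal.ofReal (L * (r + δ)) := by
        rintro y hy z ⟨τ, hτ, hz⟩
        refine (hk z y).trans ?_
        gcongr
        calc dist z y ≤ dist z (z + τ • u) + dist (z + τ • u) y := dist_triangle _ _ _
          _ ≤ r + δ := by
            refine add_le_add ?_ (hdist i _ hz _ hy)
            rw [dist_self_add_right, norm_smul, hu, mul_one, Real.norm_of_nonneg hτ.1]
            exact hτ.2
      calc ∫⁻ z in S i, k z ≤ ∫⁻ z in S i, (⨆ z ∈ S i, k z) := by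
            refine setLIntegral_mono measurable_const fun z hz => ?_
            exact le_iSup₂ (f := fun z (_ : z ∈ S i) => k z) z hz
        _ = (⨆ z ∈ S i, k z) * volume (S i) := by rw [setLIntegral_const]
        _ ≤ (⨆ z ∈ S i, k z) * (ENNReal.ofReal (r + 2 * δ) * μH[m] (K ∩ A i)) := by
            gcongr
            exact EuclideanSpace.volume_sweep_le hu (hdist i)
        _ = ENNReal.ofReal (r + 2 * δ) * ∫⁻ y in K ∩ A i, (⨆ z ∈ S i, k z) ∂μH[m] := by
            rw [setLIntegral_const]; ring
        _ ≤ _ := by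
            gcongr ENNReal.ofReal (r + 2 * δ) * ?_
            refine setLIntegral_mono (hkm.add measurable_const) fun y hy => ?_
            exact iSup₂_le fun z hz => hpt y hy z hz
    calc ∫⁻ z in {z | ∃ τ ∈ Set.Icc 0 r, z + τ • u ∈ K}, k z
        ≤ ∫⁻ z in ⋃ i, S i, k z := lintegral_mono_set hcov
      _ ≤ ∑' i, ∫⁻ z in S i, k z := lintegral_iUnion_le _ _
      _ ≤ ∑' i, ENNReal.ofReal (r + 2 * δ) *
        ∫⁻ y in K ∩ A i, (k y + ENNReal.ofReal (L * (r + δ))) ∂μH[m] :=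
          ENNReal.tsum_le_tsum hpiece
      _ = ENNReal.ofReal (r + 2 * δ) *
          ∫⁻ y in K, (k y + ENNReal.ofReal (L * (r + δ))) ∂μH[m] := by
          rw [ENNReal.tsum_mul_left, ← lintegral_iUnion (fun i => hK.inter (hAm i))
            (fun i j hij => (hAdisj hij).mono Set.inter_subset_right Set.inter_subset_right),
            ← Set.inter_iUnion, hAu, Set.inter_univ]
      _ = _ := by rw [lintegral_add_left hkm, setLIntegral_const]
  have hI : ∫⁻ y in K, k y ∂μH[m] ≠ ⊤ := by
    refine ((setLIntegral_mono measurable_const fun y _ => hkM y).trans_lt ?_).ne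
    rw [setLIntegral_const]
    exact ENNReal.mul_lt_top hM.lt_top hKfin.lt_top
  have lim : Filter.Tendsto (fun δ : ℝ => ENNReal.ofReal (r + 2 * δ) *
        (∫⁻ y in K, k y ∂μH[m] + ENNReal.ofReal (L * (r + δ)) * μH[m] K))
      (nhdsWithin 0 (Set.Ioi 0)) (nhds (ENNReal.ofReal (r + 2 * 0) *
        (∫⁻ y in K, k y ∂μH[m] + ENNReal.ofReal (L * (r + 0)) * μH[m] K))) := by
    apply Filter.Tendsto.mono_left _ nhdsWithin_le_nhds
    refine ENNReal.Tendsto.mul ?_ (.inr ?_) ?_ (.inr ENNReal.ofReal_ne_top)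
    · exact ENNReal.tendsto_ofReal (Continuous.tendsto (by fun_prop) 0)
    · exact ENNReal.add_ne_top.2 ⟨hI, ENNReal.mul_ne_top ENNReal.ofReal_ne_top hKfin⟩
    · refine tendsto_const_nhds.add (ENNReal.Tendsto.mul_const ?_ (.inr hKfin))
      exact ENNReal.tendsto_ofReal (Continuous.tendsto (by fun_prop) 0)
  simpa using ge_of_tendsto lim (eventually_mem_nhdsWithin.mono step)

/-- A Lipschitz probability density supported in a given ball around the origin. -/
theorem EuclideanSpace.exists_lipschitz_kernel (n : ℕ) {ε : ℝ} (hε : 0 < ε) :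
    ∃ (ρ : EuclideanSpace ℝ (Fin n) → ℝ≥0∞) (L : ℝ) (M : ℝ≥0∞), Measurable ρ ∧ 0 ≤ L ∧ M ≠ ⊤ ∧
      (∀ x, ρ x ≤ M) ∧ (∀ x y, ρ x ≤ ρ y + ENNReal.ofReal (L * dist x y)) ∧
      (∀ x, ε ≤ ‖x‖ → ρ x = 0) ∧ (∀ x, ρ (-x) = ρ x) ∧ ∫⁻ x, ρ x = 1 := by
  set I := ∫⁻ x : EuclideanSpace ℝ (Fin n), ENNReal.ofReal (ε - ‖x‖) with hI
  have hm : Measurable fun x : EuclideanSpace ℝ (Fin n) => ENNReal.ofReal (ε - ‖x‖) := by fun_prop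
  have hI0 : I ≠ 0 := by
    intro h
    rw [hI, lintegral_eq_zero_iff hm] at h
    have hsub : Metric.ball (0 : EuclideanSpace ℝ (Fin n)) ε ⊆
        {x | ¬ ENNReal.ofReal (ε - ‖x‖) = (0 : EuclideanSpace ℝ (Fin n) → ℝ≥0∞) x} := by
      intro x hx
      simpa using hx
    exact (Metric.measure_ball_pos volume _ hε).ne' (measure_mono_null hsub (ae_iff.1 h))
  have hIt : I ≠ ⊤ := by
    have : I ≤ ∫⁻ x in Metric.ball (0 : EuclideanSpace ℝ (Fin n)) ε, ENNReal.ofReal ε := by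
      rw [← lintegral_indicator measurableSet_ball]
      refine lintegral_mono fun x => ?_
      by_cases hx : x ∈ Metric.ball (0 : EuclideanSpace ℝ (Fin n)) ε
      · rw [Set.indicator_of_mem hx]
        exact ENNReal.ofReal_le_ofReal (by linarith [norm_nonneg x])
      · rw [Set.indicator_of_notMem hx, nonpos_iff_eq_zero, ENNReal.ofReal_eq_zero]
        simpa using hx
    refine (this.trans_lt ?_).ne
    rw [setLIntegral_const]
    exact ENNReal.mul_lt_top ENNReal.ofReal_lt_top measure_ball_lt_top
  have hIi : I⁻¹ ≠ ⊤ := ENNReal.inv_ne_top.2 hI0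
  refine ⟨fun x => ENNReal.ofReal (ε - ‖x‖) * I⁻¹, I⁻¹.toReal, ENNReal.ofReal ε * I⁻¹,
    hm.mul_const _, ENNReal.toReal_nonneg, ENNReal.mul_ne_top ENNReal.ofReal_ne_top hIi,
    fun x => ?_, fun x y => ?_, fun x hx => ?_, fun x => by simp, ?_⟩
  · dsimp only
    gcongr
    linarith [norm_nonneg x]
  · dsimp only
    rw [ENNReal.ofReal_mul ENNReal.toReal_nonneg, ENNReal.ofReal_toReal hIi, mul_comm I⁻¹,
      ← add_mul]
    gcongr
    refine (ENNReal.ofReal_le_ofReal ?_).trans ENNReal.ofReal_add_le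
    have := norm_sub_norm_le y x
    rw [dist_comm, dist_eq_norm]
    linarith
  · simp [ENNReal.ofReal_eq_zero.2 (sub_nonpos.2 hx)]
  · rw [lintegral_mul_const _ hm, ENNReal.mul_inv_cancel hI0 hIt]

theorem EuclideanSpace.isoperimetric_of_isCompact_subset {m : ℕ}
    {Ω Q : Set (EuclideanSpace ℝ (Fin (m + 1)))} (hΩ : IsOpen Ω) (hb : Bornology.IsBounded Ω)
    (hfin : μH[m] (frontier Ω) ≠ ⊤) (hQ : IsCompact Q) (hQΩ : Q ⊆ Ω) (hQ0 : volume Q ≠ 0) :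
    ENNReal.ofReal (m + 1 : ℕ) *
      volume (Metric.ball (0 : EuclideanSpace ℝ (Fin (m + 1))) 1) ^ (((m + 1 : ℕ) : ℝ)⁻¹) *
        volume Q ^ ((((m + 1 : ℕ) : ℝ) - 1) / (m + 1 : ℕ)) ≤ μH[m] (frontier Ω) := by
  set K := frontier Ω with hKdef
  have hKm : MeasurableSet K := isClosed_frontier.measurableSet
  set H := μH[m] K with hH
  have : IsFiniteMeasure ((μH[m] : Measure (EuclideanSpace ℝ (Fin (m + 1)))).restrict K) :=
    ⟨by simpa using hfin.lt_top⟩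
  obtain ⟨ε, hε, hεΩ⟩ := hQ.exists_cthickening_subset_open hΩ hQΩ
  obtain ⟨ρ, L, M, ρm, hL, hM, ρM, ρL, ρ0, ρs, ρ1⟩ :=
    EuclideanSpace.exists_lipschitz_kernel (m + 1) hε
  obtain ⟨R, hR⟩ := hb.subset_ball (0 : EuclideanSpace ℝ (Fin (m + 1)))
  set W := Metric.ball (0 : EuclideanSpace ℝ (Fin (m + 1))) (R + ε + 1) with hW
  have ρm2 : Measurable fun p : EuclideanSpace ℝ (Fin (m + 1)) × EuclideanSpace ℝ (Fin (m + 1)) =>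
    ρ (p.1 - p.2) := by fun_prop
  set f : EuclideanSpace ℝ (Fin (m + 1)) → ℝ≥0∞ := fun x => ∫⁻ y in Ω, ρ (x - y) with hf
  set G : EuclideanSpace ℝ (Fin (m + 1)) → ℝ≥0∞ := fun x => ∫⁻ y in K, ρ (x - y) ∂μH[m] with hG
  have fm : Measurable f := ρm2.lintegral_prod_right'
  have Gm : Measurable G := ρm2.lintegral_prod_right'
  have ρx : ∀ x, ∫⁻ y, ρ (x - y) = 1 := fun x => by
    rw [lintegral_sub_left_eq_self ρ x, ρ1]
  have ρy : ∀ y, ∫⁻ x, ρ (x - y) = 1 := fun y => by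
    simp_rw [sub_eq_add_neg]
    rw [lintegral_add_right_eq_self ρ (-y), ρ1]
  have f1 : ∀ x, f x ≤ 1 := fun x => (setLIntegral_le_lintegral _ _).trans (ρx x).le
  have fQ : ∀ x ∈ Q, f x = 1 := by
    intro x hx
    rw [← ρx x, ← lintegral_add_compl _ hΩ.measurableSet]
    have : ∫⁻ y in Ωᶜ, ρ (x - y) = 0 := by
      rw [setLIntegral_congr_fun hΩ.measurableSet.compl (g := fun _ => 0), lintegral_zero]
      intro y hy
      apply ρ0
      by_contra! h
      refine hy (hεΩ (Metric.mem_cthickening_of_dist_le y x ε Q hx ?_))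
      rw [dist_comm, dist_eq_norm]; exact h.le
    rw [this, add_zero]
  have f0 : ∀ x, f x ≠ 0 → ‖x‖ < R + ε := by
    intro x hx
    by_contra! h
    apply hx
    rw [hf]
    simp only
    rw [setLIntegral_congr_fun hΩ.measurableSet (g := fun _ => 0), lintegral_zero]
    intro y hy
    apply ρ0
    have h1 := hR hy
    rw [mem_ball_zero_iff] at h1
    have := norm_sub_norm_le x y
    linarith
  have If : ∫⁻ x, f x = volume Ω := by
    rw [lintegral_lintegral_swap (by exact ρm2.aemeasurable)]
    simp [ρy]
  have IG : ∫⁻ x, G x = H := by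
    rw [lintegral_lintegral_swap (by exact ρm2.aemeasurable)]
    simp [ρy, hH]
  have Gt : ∀ x, G x ≠ ⊤ := fun x => by
    refine ((setLIntegral_mono measurable_const fun y _ => ρM _).trans_lt ?_).ne
    rw [setLIntegral_const]
    exact ENNReal.mul_lt_top hM.lt_top hfin.lt_top
  have shift : ∀ t > 0, ∀ x w, ‖w‖ ≤ t →
      f (x + w) ≤ f x + ENNReal.ofReal t * (G x + ENNReal.ofReal (L * t) * H) := by
    intro t ht x w hw
    rcases eq_or_ne w 0 with rfl | hw0
    · simp
    have hwpos : 0 < ‖w‖ := norm_pos_iff.2 hw0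
    set u := ‖w‖⁻¹ • w with hu
    have hu1 : ‖u‖ = 1 := norm_smul_inv_norm hw0
    have hsw : w = ‖w‖ • u := by rw [hu, smul_inv_smul₀ hwpos.ne']
    have h1 : f (x + w) = ∫⁻ z in (fun z => z + w) ⁻¹' Ω, ρ (x - z) := by
      rw [hf]
      simp only
      rw [← (measurePreserving_add_right volume w).setLIntegral_comp_preimage hΩ.measurableSet
        (by fun_prop)]
      simp
    have h2 : (fun z => z + w) ⁻¹' Ω ⊆ Ω ∪ {z | ∃ τ ∈ Set.Icc 0 ‖w‖, z + τ • u ∈ K} := by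
      intro z hz
      by_cases hzΩ : z ∈ Ω
      · exact .inl hzΩ
      · obtain ⟨s, hs, hsK⟩ := exists_add_smul_mem_frontier hΩ hzΩ hz
        refine .inr ⟨s * ‖w‖, ⟨by have := hs.1; positivity, ?_⟩, ?_⟩
        · exact mul_le_of_le_one_left hwpos.le hs.2
        · rwa [mul_smul, ← hsw]
    rw [h1]
    refine (lintegral_mono_set h2).trans ((lintegral_union_le _ _ _).trans ?_)
    gcongr
    refine (EuclideanSpace.lintegral_sweep_le hu1 hKm hfin hL
      (k := fun z => ρ (x - z)) (by fun_prop) hM (fun z => ρM _) (fun z y => ?_)).trans ?_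
    · have := ρL (x - z) (x - y)
      rwa [dist_sub_left] at this
    · gcongr
  set c := volume (Metric.ball (0 : EuclideanSpace ℝ (Fin (m + 1))) 1) ^
    (((m + 1 : ℕ) : ℝ)⁻¹) with hc
  set e := (((m + 1 : ℕ) : ℝ) - 1) / (m + 1 : ℕ) with he
  have he0 : 0 ≤ e := by rw [he]; push_cast; rw [add_sub_cancel_right]; positivity
  set V := ENNReal.ofReal (m + 1 : ℕ) * c * volume Q ^ e with hV
  have main : ∀ t > 0, t ≤ 1 → V ≤ H + ENNReal.ofReal (L * t) * H * volume W := by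
    intro t ht ht1
    set g : EuclideanSpace ℝ (Fin (m + 1)) → ℝ≥0∞ := fun x =>
      f x + ENNReal.ofReal t * (G x + W.indicator (fun _ => ENNReal.ofReal (L * t) * H) x) with hg
    have gm : Measurable g := fm.add
      ((Gm.add (measurable_const.indicator measurableSet_ball)).const_mul _)
    have gt : ∀ x, g x ≠ ⊤ := by
      intro x
      refine ENNReal.add_ne_top.2 ⟨((f1 x).trans_lt ENNReal.one_lt_top).ne,
        ENNReal.mul_ne_top ENNReal.ofReal_ne_top (ENNReal.add_ne_top.2 ⟨Gt x, ?_⟩)⟩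
      refine ((Set.indicator_le_self' (by simp) x).trans_lt ?_).ne
      exact ENNReal.mul_lt_top ENNReal.ofReal_lt_top hfin.lt_top
    have ft : ∀ x, f x ≠ ⊤ := fun x => ((f1 x).trans_lt ENNReal.one_lt_top).ne
    have fg : ∀ x, f x ≤ g x := fun x => le_self_add
    have layer : ∀ k : EuclideanSpace ℝ (Fin (m + 1)) → ℝ≥0∞, Measurable k → (∀ x, k x ≠ ⊤) →
        ∫⁻ x, k x = ∫⁻ s in Set.Ioi (0 : ℝ), volume {x | s < (k x).toReal} := by
      intro k hk hkt
      rw [← lintegral_eq_lintegral_meas_lt _ (.of_forall fun x => ENNReal.toReal_nonneg)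
        (by fun_prop)]
      exact lintegral_congr fun x => (ENNReal.ofReal_toReal (hkt x)).symm
    have Ig : ∫⁻ x, g x = (∫⁻ x, f x) + ENNReal.ofReal t *
        (H + ENNReal.ofReal (L * t) * H * volume W) := by
      rw [hg, lintegral_add_left fm, lintegral_const_mul' _ _ ENNReal.ofReal_ne_top,
        lintegral_add_left Gm, IG, lintegral_indicator_const measurableSet_ball]
    have hlow : (∫⁻ x, f x) + ENNReal.ofReal t * V ≤ ∫⁻ x, g x := by
      have e1 : ENNReal.ofReal t * V = ∫⁻ s in Set.Ioi (0 : ℝ),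
          (Set.Iio (1 : ℝ)).indicator (fun _ => ENNReal.ofReal t * V) s := by
        rw [lintegral_indicator_const measurableSet_Iio, Measure.restrict_apply measurableSet_Iio,
          Set.Iio_inter_Ioi]
        simp
      rw [layer f fm ft, layer g gm gt, e1, ← lintegral_add_right _
        (measurable_const.indicator measurableSet_Iio)]
      refine setLIntegral_mono' measurableSet_Ioi fun s (hs : 0 < s) => ?_
      by_cases hs1 : s < 1
      · rw [Set.indicator_of_mem (by exact hs1)]
        have hQs : Q ⊆ {x | s < (f x).toReal} := fun x hx => by simpa [fQ x hx] using hs1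
        have hA0 : volume {x | s < (f x).toReal} ≠ 0 := fun h => hQ0 (measure_mono_null hQs h)
        refine le_trans ?_ (EuclideanSpace.volume_add_le_of_add_ball_subset (Nat.succ_ne_zero m)
          (measurableSet_lt measurable_const fm.ennreal_toReal)
          (measurableSet_lt measurable_const gm.ennreal_toReal) hA0 ht ?_)
        · rw [hV, ENNReal.ofReal_mul (by positivity), mul_comm (ENNReal.ofReal (m + 1 : ℕ)),
            mul_comm (ENNReal.ofReal (m + 1 : ℕ)), ← hc, ← he, mul_assoc, mul_assoc, mul_assoc,
            mul_left_comm c]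
          gcongr
        · intro a ha b hb
          simp only [Set.mem_ofPred_eq] at ha ⊢
          refine ha.trans_le (ENNReal.toReal_mono (gt _) ?_)
          rw [mem_ball_zero_iff] at hb
          have := shift t ht (a + b) (-b) (by rw [norm_neg]; exact hb.le)
          rw [add_neg_cancel_right] at this
          have haW : a + b ∈ W := by
            have h1 := f0 a (by rintro h; rw [h] at ha; simp at ha; linarith)
            rw [hW, mem_ball_zero_iff]
            have := norm_add_le a b
            linarith
          simpa [hg, Set.indicator_of_mem haW] using this
      · rw [Set.indicator_of_notMem (by exact hs1), add_zero]
        exact measure_mono fun x (hx : s < _) => hx.trans_le (ENNReal.toReal_mono (gt x) (fg x))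
    rw [Ig] at hlow
    have hft : ∫⁻ x, f x ≠ ⊤ := If ▸ hb.measure_lt_top.ne
    have := (ENNReal.add_le_add_iff_left hft).1 hlow
    exact (ENNReal.mul_le_mul_iff_right (by simpa using ht) ENNReal.ofReal_ne_top).1 this
  have hWt : volume W ≠ ⊤ := measure_ball_lt_top.ne
  have lim : Filter.Tendsto (fun t : ℝ => H + ENNReal.ofReal (L * t) * H * volume W)
      (nhdsWithin 0 (Set.Ioi 0)) (nhds (H + ENNReal.ofReal (L * 0) * H * volume W)) := by
    apply Filter.Tendsto.mono_left _ nhdsWithin_le_nhds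
    refine tendsto_const_nhds.add (ENNReal.Tendsto.mul_const (ENNReal.Tendsto.mul_const ?_
      (.inr hfin)) (.inr hWt))
    exact ENNReal.tendsto_ofReal (Continuous.tendsto (by fun_prop) 0)
  simpa using ge_of_tendsto lim (Filter.mem_of_superset (Ioc_mem_nhdsGT one_pos)
    fun t ht => main t ht.1 ht.2)

/-- The isoperimetric inequality for bounded open sets, in terms of the Hausdorff measure of the
topological boundary. -/
theorem EuclideanSpace.isoperimetric {m : ℕ} (hm : 0 < m)
    {Ω : Set (EuclideanSpace ℝ (Fin (m + 1)))} (hΩ : IsOpen Ω) (hb : Bornology.IsBounded Ω) :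
    ENNReal.ofReal (m + 1 : ℕ) *
      volume (Metric.ball (0 : EuclideanSpace ℝ (Fin (m + 1))) 1) ^ (((m + 1 : ℕ) : ℝ)⁻¹) *
        volume Ω ^ ((((m + 1 : ℕ) : ℝ) - 1) / (m + 1 : ℕ)) ≤ μH[m] (frontier Ω) := by
  rcases eq_or_ne (μH[m] (frontier Ω)) ⊤ with hfin | hfin
  · simp [hfin]
  set c := ENNReal.ofReal (m + 1 : ℕ) * volume (Metric.ball (0 : EuclideanSpace ℝ (Fin (m + 1))) 1)
    ^ (((m + 1 : ℕ) : ℝ)⁻¹) with hc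
  set e := (((m + 1 : ℕ) : ℝ) - 1) / (m + 1 : ℕ) with he
  have he0 : 0 < e := by rw [he]; push_cast; rw [add_sub_cancel_right]; positivity
  have key : ∀ r < volume Ω, c * r ^ e ≤ μH[m] (frontier Ω) := by
    intro r hr
    obtain ⟨Q, hQΩ, hQ, hrQ⟩ := hΩ.exists_lt_isCompact hr
    refine le_trans ?_ (EuclideanSpace.isoperimetric_of_isCompact_subset hΩ hb hfin hQ hQΩ
      (zero_le.trans_lt hrQ).ne')
    gcongr
  rcases eq_or_ne (volume Ω) 0 with h0 | h0
  · simp [h0, ENNReal.zero_rpow_of_pos he0]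
  have := nhdsLT_neBot_of_exists_lt ⟨0, pos_iff_ne_zero.2 h0⟩
  have lim : Filter.Tendsto (fun r : ℝ≥0∞ => c * r ^ e) (nhdsWithin (volume Ω) (Set.Iio (volume Ω)))
      (nhds (c * volume Ω ^ e)) := by
    refine ENNReal.Tendsto.const_mul ?_ (.inr ?_)
    · exact (ENNReal.continuous_rpow_const.tendsto _).mono_left nhdsWithin_le_nhds
    · exact ENNReal.mul_ne_top ENNReal.ofReal_ne_top
        (ENNReal.rpow_ne_top_of_nonneg (by positivity) measure_ball_lt_top.ne)
  exact le_of_tendsto lim (eventually_mem_nhdsWithin.mono key)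

/-- The conformal factor of `invStereographic`. -/
noncomputable def conformalFactor {n : ℕ} (c : EuclideanSpace ℝ (Fin n)) (t : ℝ)
    (x : EuclideanSpace ℝ (Fin n)) : ℝ :=
  2 * t / (‖x - c‖ ^ 2 + t ^ 2)

/-- The inverse stereographic projection onto the unit sphere, precomposed with the
similarity of centre `c` and ratio `t⁻¹`. -/
noncomputable def invStereographic {n : ℕ} (c : EuclideanSpace ℝ (Fin n)) (t : ℝ)
    (x : EuclideanSpace ℝ (Fin n)) : EuclideanSpace ℝ (Fin (n + 1)) :=
  WithLp.toLp 2 (Fin.cons (t * conformalFactor c t x - 1)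
    fun i => conformalFactor c t x * (x i - c i))

section Stereographic

variable {n : ℕ} (c : EuclideanSpace ℝ (Fin n)) {t : ℝ}

@[simp]
theorem invStereographic_zero (x : EuclideanSpace ℝ (Fin n)) :
    invStereographic c t x 0 = t * conformalFactor c t x - 1 := rfl

@[simp]
theorem invStereographic_succ (x : EuclideanSpace ℝ (Fin n)) (i : Fin n) :
    invStereographic c t x i.succ = conformalFactor c t x * (x i - c i) := rfl

theorem conformalFactor_mul (ht : 0 < t) (x : EuclideanSpace ℝ (Fin n)) :
    conformalFactor c t x * (‖x - c‖ ^ 2 + t ^ 2) = 2 * t :=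
  div_mul_cancel₀ _ (by positivity)

theorem conformalFactor_pos (ht : 0 < t) (x : EuclideanSpace ℝ (Fin n)) :
    0 < conformalFactor c t x := by
  unfold conformalFactor; positivity

theorem conformalFactor_le (ht : 0 < t) (x : EuclideanSpace ℝ (Fin n)) :
    conformalFactor c t x ≤ 2 / t := by
  unfold conformalFactor
  rw [div_le_div_iff₀ (by positivity) ht]
  nlinarith [sq_nonneg ‖x - c‖]

theorem contDiff_conformalFactor (ht : 0 < t) {k : WithTop ℕ∞} :
    ContDiff ℝ k (conformalFactor c t) := by
  unfold conformalFactor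
  refine contDiff_const.div (((contDiff_id.sub contDiff_const).norm_sq ℝ).add contDiff_const) ?_
  intro x
  positivity

theorem dist_sq_invStereographic (ht : 0 < t) (x y : EuclideanSpace ℝ (Fin n)) :
    dist (invStereographic c t x) (invStereographic c t y) ^ 2 =
      conformalFactor c t x * conformalFactor c t y * dist x y ^ 2 := by
  have h1 := conformalFactor_mul c ht x
  have h2 := conformalFactor_mul c ht y
  set a := conformalFactor c t x
  set b := conformalFactor c t y
  have h : dist (invStereographic c t x) (invStereographic c t y) ^ 2 =
      t ^ 2 * (a - b) ^ 2 + ‖a • (x - c) - b • (y - c)‖ ^ 2 := by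
    rw [dist_eq_norm, EuclideanSpace.norm_sq_eq, Fin.sum_univ_succ, EuclideanSpace.norm_sq_eq]
    simp only [PiLp.sub_apply, PiLp.smul_apply, invStereographic_zero, invStereographic_succ,
      Real.norm_eq_abs, sq_abs, smul_eq_mul]
    ring
  have hxy : dist x y ^ 2 = ‖x - c‖ ^ 2 - 2 * inner ℝ (x - c) (y - c) + ‖y - c‖ ^ 2 := by
    rw [← norm_sub_sq_real, dist_eq_norm]
    congr 2
    abel
  rw [h, hxy, norm_sub_sq_real, norm_smul, norm_smul, real_inner_smul_left, real_inner_smul_right,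
    mul_pow, mul_pow, Real.norm_eq_abs, Real.norm_eq_abs, sq_abs, sq_abs]
  linear_combination (a - b) * h1 + (b - a) * h2

theorem norm_invStereographic (ht : 0 < t) (x : EuclideanSpace ℝ (Fin n)) :
    ‖invStereographic c t x‖ = 1 := by
  have h1 := conformalFactor_mul c ht x
  rw [← sq_eq_sq₀ (norm_nonneg _) zero_le_one, EuclideanSpace.norm_sq_eq, Fin.sum_univ_succ]
  simp only [invStereographic_zero, invStereographic_succ, Real.norm_eq_abs, sq_abs, mul_pow]
  rw [← Finset.mul_sum]
  have : ∑ i, (x i - c i) ^ 2 = ‖x - c‖ ^ 2 := by simp [EuclideanSpace.norm_sq_eq]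
  rw [this]
  linear_combination conformalFactor c t x * h1

theorem lipschitzWith_invStereographic (ht : 0 < t) :
    LipschitzWith (2 / t).toNNReal (invStereographic c t) := by
  refine LipschitzWith.of_dist_le_mul fun x y => ?_
  have h2t : 0 ≤ 2 / t := by positivity
  rw [Real.coe_toNNReal _ h2t]
  refine (sq_le_sq₀ (by positivity) (by positivity)).1 ?_
  rw [dist_sq_invStereographic c ht, mul_pow, sq (2 / t)]
  have := conformalFactor_le c ht x
  have := conformalFactor_le c ht y
  have := (conformalFactor_pos c ht x).le
  have := (conformalFactor_pos c ht y).le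
  gcongr

theorem le_dist_invStereographic (ht : 0 < t) {a : ℝ} (ha : 0 ≤ a)
    {x y : EuclideanSpace ℝ (Fin n)} (hx : a ≤ conformalFactor c t x)
    (hy : a ≤ conformalFactor c t y) :
    a * dist x y ≤ dist (invStereographic c t x) (invStereographic c t y) := by
  refine (sq_le_sq₀ (by positivity) (by positivity)).1 ?_
  rw [dist_sq_invStereographic c ht, mul_pow, sq a]
  have := (conformalFactor_pos c ht x).le
  gcongr

theorem injective_invStereographic (ht : 0 < t) : Function.Injective (invStereographic c t) := by
  intro x y h
  have := dist_sq_invStereographic c ht x y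
  rw [h, dist_self] at this
  have h1 := (mul_pos (conformalFactor_pos c ht x) (conformalFactor_pos c ht y)).ne'
  simpa [h1] using this

theorem EuclideanSpace.volume_le_hausdorffMeasure (A : Set (EuclideanSpace ℝ (Fin n))) :
    volume A ≤ μH[n] A := by
  have hP := PiLp.volume_preserving_ofLp (Fin n)
  calc volume A ≤ volume (WithLp.ofLp ⁻¹' (WithLp.ofLp '' A)) :=
        measure_mono (Set.subset_preimage_image _ _)
    _ ≤ Measure.map WithLp.ofLp volume (WithLp.ofLp '' A) :=
        Measure.le_map_apply hP.aemeasurable _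
    _ = μH[n] (WithLp.ofLp '' A) := by
        rw [hP.map_eq, ← hausdorffMeasure_pi_real, Fintype.card_fin]
    _ ≤ μH[n] A := by
        simpa using (PiLp.lipschitzWith_ofLp 2 fun _ : Fin n => ℝ).hausdorffMeasure_image_le
          (d := n) (by positivity) A

theorem volume_mul_le_hausdorffMeasure_image (ht : 0 < t) {a : ℝ} (ha : 0 < a)
    {A : Set (EuclideanSpace ℝ (Fin n))} (hA : ∀ x ∈ A, a ≤ conformalFactor c t x) :
    ENNReal.ofReal a ^ n * volume A ≤ μH[n] (invStereographic c t '' A) := by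
  set g := Function.invFun (invStereographic c t)
  have hg : Function.LeftInverse g (invStereographic c t) :=
    Function.leftInverse_invFun (injective_invStereographic c ht)
  have hL : LipschitzOnWith (a⁻¹).toNNReal g (invStereographic c t '' A) := by
    refine LipschitzOnWith.of_dist_le_mul ?_
    rintro _ ⟨x, hx, rfl⟩ _ ⟨y, hy, rfl⟩
    rw [hg, hg, Real.coe_toNNReal _ (by positivity), inv_mul_eq_div, le_div_iff₀' ha]
    exact le_dist_invStereographic c ht ha.le (hA x hx) (hA y hy)
  have himg := hL.hausdorffMeasure_image_le (d := n) (by positivity)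
  rw [Set.image_image] at himg
  simp only [hg _, Set.image_id'] at himg
  have ha' : ENNReal.ofReal a ≠ 0 := by simpa using ha
  calc ENNReal.ofReal a ^ n * volume A
      ≤ ENNReal.ofReal a ^ n * (ENNReal.ofReal a⁻¹ ^ n * μH[n] (invStereographic c t '' A)) := by
        gcongr
        refine (EuclideanSpace.volume_le_hausdorffMeasure A).trans ?_
        simpa [ENNReal.ofReal] using himg
    _ = _ := by
        rw [← mul_assoc, ← mul_pow, ENNReal.ofReal_inv_of_pos ha,
          ENNReal.mul_inv_cancel ha' ENNReal.ofReal_ne_top, one_pow, one_mul]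

theorem lintegral_conformalFactor_pow_le (ht : 0 < t) :
    ∫⁻ x, ENNReal.ofReal (conformalFactor c t x) ^ n ≤
      μH[n] {y : EuclideanSpace ℝ (Fin (n + 1)) | ‖y‖ = 1} := by
  set H := μH[n] {y : EuclideanSpace ℝ (Fin (n + 1)) | ‖y‖ = 1} with hH
  have hc : Continuous (conformalFactor c t) := (contDiff_conformalFactor c ht (k := 0)).continuous
  have step : ∀ q : ℝ, 1 < q → ∫⁻ x, ENNReal.ofReal (conformalFactor c t x) ^ n ≤
      ENNReal.ofReal q ^ n * H := by
    intro q hq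
    have q0 : 0 < q := by linarith
    set A : ℤ → Set (EuclideanSpace ℝ (Fin n)) := fun k =>
      conformalFactor c t ⁻¹' Set.Ico (q ^ k) (q ^ (k + 1)) with hA
    have hAm : ∀ k, MeasurableSet (A k) := fun k => hc.measurable measurableSet_Ico
    have hAu : ⋃ k, A k = Set.univ := by
      refine Set.eq_univ_of_forall fun x => ?_
      obtain ⟨k, hk⟩ := exists_mem_Ico_zpow (conformalFactor_pos c ht x) hq
      exact Set.mem_iUnion.2 ⟨k, hk⟩
    have hAd : Pairwise fun i j => Disjoint (A i) (A j) := fun i j hij =>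
      ((zpow_right_mono₀ hq.le).pairwise_disjoint_on_Ico_succ hij).preimage _
    have hpiece : ∀ k, ∫⁻ x in A k, ENNReal.ofReal (conformalFactor c t x) ^ n ≤
        ENNReal.ofReal q ^ n * μH[n] (invStereographic c t '' A k) := by
      intro k
      calc ∫⁻ x in A k, ENNReal.ofReal (conformalFactor c t x) ^ n
          ≤ ∫⁻ x in A k, (ENNReal.ofReal q * ENNReal.ofReal (q ^ k)) ^ n := by
            refine setLIntegral_mono measurable_const fun x hx => ?_
            rw [← ENNReal.ofReal_mul q0.le, ← zpow_one_add₀ q0.ne', add_comm]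
            gcongr
            exact hx.2.le
        _ = ENNReal.ofReal q ^ n * (ENNReal.ofReal (q ^ k) ^ n * volume (A k)) := by
            rw [setLIntegral_const, mul_pow, mul_assoc]
        _ ≤ _ := by
            gcongr
            exact volume_mul_le_hausdorffMeasure_image c ht (by positivity) fun x hx => hx.1
    have him : ∀ k, MeasurableSet (invStereographic c t '' A k) := fun k =>
      (hAm k).image_of_continuousOn_injOn
        (lipschitzWith_invStereographic c ht).continuous.continuousOn
        (injective_invStereographic c ht).injOn
    calc ∫⁻ x, ENNReal.ofReal (conformalFactor c t x) ^ n
        = ∑' k, ∫⁻ x in A k, ENNReal.ofReal (conformalFactor c t x) ^ n := by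
          rw [← lintegral_iUnion hAm hAd, hAu, setLIntegral_univ]
      _ ≤ ∑' k, ENNReal.ofReal q ^ n * μH[n] (invStereographic c t '' A k) :=
          ENNReal.tsum_le_tsum hpiece
      _ = ENNReal.ofReal q ^ n * μH[n] (⋃ k, invStereographic c t '' A k) := by
          rw [ENNReal.tsum_mul_left, measure_iUnion _ him]
          exact fun i j hij => (Set.disjoint_image_iff (injective_invStereographic c ht)).2 (hAd hij)
      _ ≤ _ := by
          gcongr
          refine measure_mono (Set.iUnion_subset ?_)
          rintro k _ ⟨x, -, rfl⟩
          exact norm_invStereographic c ht x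
  rcases eq_or_ne H ⊤ with hHt | hHt
  · rw [hHt]; exact le_top
  have lim : Filter.Tendsto (fun q : ℝ => ENNReal.ofReal q ^ n * H) (nhdsWithin 1 (Set.Ioi 1))
      (nhds (ENNReal.ofReal 1 ^ n * H)) := by
    apply Filter.Tendsto.mono_left _ nhdsWithin_le_nhds
    refine ENNReal.Tendsto.mul_const (ENNReal.Tendsto.pow ?_) (.inr hHt)
    exact ENNReal.tendsto_ofReal Filter.tendsto_id
  simpa using ge_of_tendsto lim (eventually_mem_nhdsWithin.mono step)

theorem hausdorffMeasure_unitSphere_lt_top (n : ℕ) :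
    μH[n] {y : EuclideanSpace ℝ (Fin (n + 1)) | ‖y‖ = 1} < ⊤ := by
  set S := invStereographic (0 : EuclideanSpace ℝ (Fin n)) 1
  set B := Metric.closedBall (0 : EuclideanSpace ℝ (Fin n)) 1
  have hB : μH[n] (S '' B) < ⊤ := by
    refine ((lipschitzWith_invStereographic _ one_pos).hausdorffMeasure_image_le (d := n)
      (by positivity) B).trans_lt ?_
    have := isAddHaarMeasure_hausdorffMeasure (E := EuclideanSpace ℝ (Fin n))
    rw [finrank_euclideanSpace_fin] at this
    refine ENNReal.mul_lt_top (by simp) (isCompact_closedBall 0 1).measure_lt_top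
  have hS : ∀ y : EuclideanSpace ℝ (Fin (n + 1)), ‖y‖ = 1 → 0 ≤ y 0 → y ∈ S '' B := by
    intro y hy h0
    have hn : y 0 ^ 2 + ∑ i : Fin n, y i.succ ^ 2 = 1 := by
      have := EuclideanSpace.norm_sq_eq y
      rw [hy, Fin.sum_univ_succ] at this
      simpa using this.symm
    set x : EuclideanSpace ℝ (Fin n) := WithLp.toLp 2 fun i => y i.succ / (1 + y 0) with hx
    have hxn : ‖x‖ ^ 2 = (1 - y 0) / (1 + y 0) := by
      rw [EuclideanSpace.norm_sq_eq]
      simp only [hx, Real.norm_eq_abs, sq_abs, div_pow]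
      rw [← Finset.sum_div, div_eq_div_iff (by positivity) (by positivity)]
      linear_combination (1 + y 0) * hn
    have hl : conformalFactor 0 1 x = 1 + y 0 := by
      unfold conformalFactor
      rw [sub_zero, hxn]
      field_simp
      ring
    refine ⟨x, ?_, ?_⟩
    · rw [mem_closedBall_zero_iff, ← sq_le_one_iff₀ (norm_nonneg _), hxn,
        div_le_one (by positivity)]
      linarith
    · ext i
      refine Fin.cases ?_ (fun i => ?_) i
      · simp [S, hl]
      · rw [invStereographic_succ, hl]
        simp only [hx, PiLp.zero_apply, sub_zero]
        field_simp
  have hcov : {y : EuclideanSpace ℝ (Fin (n + 1)) | ‖y‖ = 1} ⊆ S '' B ∪ -(S '' B) := by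
    intro y hy
    rcases le_total 0 (y 0) with h | h
    · exact .inl (hS y hy h)
    · exact .inr (hS (-y) (by simpa using hy) (by simpa using h))
  refine (measure_mono hcov).trans_lt ((measure_union_le _ _).trans_lt (ENNReal.add_lt_top.2 ⟨hB, ?_⟩))
  rwa [← Set.image_neg_eq_neg, (LinearIsometryEquiv.neg ℝ).isometry.hausdorffMeasure_image]
  exact .inl n.cast_nonneg

end Stereographic

theorem exists_forall_measure_ball_lt {X : Type*} [MetricSpace X] [MeasurableSpace X] [BorelSpace X]
    (μ : Measure X) [IsFiniteMeasure μ] [NullSingletonClass μ] {K : Set X} (hK : IsCompact K)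
    (hμK : μ Kᶜ = 0) {ε : ℝ≥0∞} (hε : 0 < ε) : ∃ r > 0, ∀ c, μ (Metric.ball c r) < ε := by
  have : ∀ x : X, ∃ U, {x} ⊆ U ∧ IsOpen U ∧ μ U < ε := fun x =>
    Set.exists_isOpen_lt_of_lt {x} ε (by simpa using hε)
  choose U hxU hUo hU using this
  obtain ⟨δ, hδ, h⟩ := lebesgue_number_lemma_of_metric hK hUo
    fun x _ => Set.mem_iUnion.2 ⟨x, hxU x rfl⟩
  refine ⟨δ / 2, half_pos hδ, fun c => ?_⟩
  by_cases hc : ∃ x ∈ K, x ∈ Metric.ball c (δ / 2)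
  · obtain ⟨x, hxK, hxc⟩ := hc
    obtain ⟨i, hi⟩ := h x hxK
    refine (measure_mono (Set.Subset.trans ?_ hi)).trans_lt (hU i)
    intro y hy
    rw [Metric.mem_ball] at *
    linarith [dist_triangle_right y x c]
  · push Not at hc
    rwa [measure_mono_null (fun x hx hxK => hc x hxK hx) hμK]

/-- The energy whose critical points are the conformal centres of mass of `μ`. -/
noncomputable def conformalEnergy {n : ℕ} (μ : Measure (EuclideanSpace ℝ (Fin n)))
    (p : EuclideanSpace ℝ (Fin n) × ℝ) : ℝ :=
  ∫ x, (Real.log (‖x - p.1‖ ^ 2 + Real.exp (2 * p.2)) - p.2) ∂μ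

section ConformalEnergy

variable {n : ℕ} (μ : Measure (EuclideanSpace ℝ (Fin n))) [IsFiniteMeasure μ]
  {K : Set (EuclideanSpace ℝ (Fin n))}

theorem Continuous.integrable_of_restrict_eq {E : Type*} [NormedAddCommGroup E]
    (hK : IsCompact K) (hμK : μ.restrict K = μ)
    {f : EuclideanSpace ℝ (Fin n) → E} (hf : Continuous f) : Integrable f μ := by
  have := hf.continuousOn.integrableOn_compact (μ := μ) hK
  rwa [IntegrableOn, hμK] at this

theorem continuous_conformalIntegrand : Continuous
    fun q : (EuclideanSpace ℝ (Fin n) × ℝ) × EuclideanSpace ℝ (Fin n) =>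
      Real.log (‖q.2 - q.1.1‖ ^ 2 + Real.exp (2 * q.1.2)) - q.1.2 := by
  refine Continuous.sub (Continuous.log (by fun_prop) fun q => ?_) (by fun_prop)
  positivity

theorem integrable_conformalIntegrand (hK : IsCompact K) (hμK : μ.restrict K = μ)
    (p : EuclideanSpace ℝ (Fin n) × ℝ) :
    Integrable (fun x => Real.log (‖x - p.1‖ ^ 2 + Real.exp (2 * p.2)) - p.2) μ :=
  Continuous.integrable_of_restrict_eq μ hK hμK
    ((Continuous.log (by fun_prop) fun x => by positivity).sub continuous_const)

theorem continuous_conformalEnergy (hK : IsCompact K) (hμK : μ.restrict K = μ) :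
    Continuous (conformalEnergy μ) := by
  have := continuous_parametric_integral_of_continuous (μ := μ)
    (f := fun (p : EuclideanSpace ℝ (Fin n) × ℝ) (x : EuclideanSpace ℝ (Fin n)) =>
      Real.log (‖x - p.1‖ ^ 2 + Real.exp (2 * p.2)) - p.2) continuous_conformalIntegrand hK
  rwa [hμK] at this

theorem mul_le_conformalEnergy (hK : IsCompact K) (hμK : μ.restrict K = μ)
    {a : ℝ} {p : EuclideanSpace ℝ (Fin n) × ℝ}
    (h : ∀ x ∈ K, a ≤ Real.log (‖x - p.1‖ ^ 2 + Real.exp (2 * p.2)) - p.2) :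
    μ.real Set.univ * a ≤ conformalEnergy μ p := by
  have hint := integrable_conformalIntegrand μ hK hμK p
  unfold conformalEnergy
  rw [← hμK] at hint ⊢
  rw [Measure.real, Measure.restrict_apply_univ, ← Measure.real, ← smul_eq_mul, ← setIntegral_const]
  exact setIntegral_mono_on (integrableOn_const (measure_ne_top _ _)) hint hK.measurableSet h

theorem exists_forall_conformalEnergy_le (hK : IsCompact K) (hμK : μ.restrict K = μ)
    [NullSingletonClass μ] (hμ : μ ≠ 0) :
    ∃ p, ∀ q, conformalEnergy μ p ≤ conformalEnergy μ q := by
  set M := μ.real Set.univ with hM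
  have hM0 : 0 < M := ENNReal.toReal_pos (by simpa using hμ) (measure_ne_top _ _)
  obtain ⟨R, hR⟩ := hK.isBounded.subset_closedBall 0
  have hμK0 : μ Kᶜ = 0 := by
    rw [← hμK, Measure.restrict_apply hK.measurableSet.compl]; simp
  obtain ⟨r, hr, hball⟩ := exists_forall_measure_ball_lt μ hK hμK0
    (ε := ENNReal.ofReal (M / 3)) (by simpa using hM0)
  set B := conformalEnergy μ 0 with hB
  refine (continuous_conformalEnergy μ hK hμK).exists_forall_le' 0 ?_
  rw [Filter.Eventually, Filter.mem_cocompact]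
  set s₀ := min (Real.log r) (-(3 / M) * (B - 4 / 3 * M * Real.log r))
  refine ⟨Metric.closedBall 0 (R + Real.exp (B / M) / 2) ×ˢ Set.Icc s₀ (B / M),
    (isCompact_closedBall _ _).prod isCompact_Icc, ?_⟩
  rintro ⟨c, s⟩ hp
  by_contra hlt
  simp only [Set.mem_ofPred_eq, not_le] at hlt
  change conformalEnergy μ (c, s) < B at hlt
  refine hp ⟨?_, ?_, ?_⟩
  · rw [mem_closedBall_zero_iff]
    by_contra! hc
    have hcR : 0 < ‖c‖ - R := by linarith [Real.exp_pos (B / M)]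
    have := mul_le_conformalEnergy μ hK hμK (p := (c, s)) (a := B / M) (fun x hx => ?_)
    · rw [mul_div_cancel₀ _ hM0.ne'] at this
      linarith
    · have hx := hR hx
      rw [mem_closedBall_zero_iff] at hx
      have h1 : ‖c‖ - R ≤ ‖x - c‖ := by linarith [norm_sub_norm_le c x, norm_sub_rev c x]
      rw [le_sub_iff_add_le, Real.le_log_iff_exp_le (by positivity), Real.exp_add, two_mul s,
        Real.exp_add]
      nlinarith [sq_nonneg (‖x - c‖ - Real.exp s), Real.exp_pos s]
  · by_contra! hs
    have hs1 : s < Real.log r := hs.trans_le (min_le_left _ _)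
    have hs2 : s < -(3 / M) * (B - 4 / 3 * M * Real.log r) := hs.trans_le (min_le_right _ _)
    have hint := integrable_conformalIntegrand μ hK hμK (c, s)
    have hle : ∫ x, ((-s + 2 * Real.log r) + (Metric.ball c r).indicator
        (fun _ => 2 * (s - Real.log r)) x) ∂μ ≤ conformalEnergy μ (c, s) := by
      refine integral_mono ((integrable_const _).add
        ((integrable_const _).indicator measurableSet_ball)) hint fun x => ?_
      by_cases hx : x ∈ Metric.ball c r
      · simp only [Set.indicator_of_mem hx]
        rw [le_sub_iff_add_le, Real.le_log_iff_exp_le (by positivity)]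
        calc _ = Real.exp (2 * s) := by congr 1; ring
          _ ≤ _ := le_add_of_nonneg_left (by positivity)
      · simp only [Set.indicator_of_notMem hx, add_zero]
        rw [le_sub_iff_add_le, Real.le_log_iff_exp_le (by positivity)]
        rw [Metric.mem_ball, not_lt, dist_eq_norm] at hx
        calc _ = r ^ 2 := by
              rw [neg_add_eq_sub, sub_add_cancel, two_mul, Real.exp_add, Real.exp_log hr, sq]
          _ ≤ ‖x - c‖ ^ 2 := by gcongr
          _ ≤ _ := le_add_of_nonneg_right (by positivity)
    rw [integral_add (integrable_const _) ((integrable_const _).indicator measurableSet_ball),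
      integral_const, integral_indicator_const _ measurableSet_ball, smul_eq_mul, smul_eq_mul,
      ← hM] at hle
    have hm : μ.real (Metric.ball c r) ≤ M / 3 :=
      ENNReal.toReal_le_of_le_ofReal (by positivity) (hball c).le
    have h3 : M / 3 * s < - (B - 4 / 3 * M * Real.log r) := by
      have := mul_lt_mul_of_pos_left hs2 (by positivity : 0 < M / 3)
      refine this.trans_eq ?_
      field_simp
    nlinarith [mul_le_mul_of_nonneg_right hm (by linarith : 0 ≤ 2 * (Real.log r - s))]
  · by_contra! hs
    have := mul_le_conformalEnergy μ hK hμK (p := (c, s)) (a := s) (fun x hx => ?_)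
    · rw [div_lt_iff₀' hM0] at hs
      linarith
    · rw [le_sub_iff_add_le, ← two_mul, Real.le_log_iff_exp_le (by positivity)]
      exact le_add_of_nonneg_left (by positivity)

theorem exists_integral_invStereographic_eq_zero (hK : IsCompact K) (hμK : μ.restrict K = μ)
    [NullSingletonClass μ] (hμ : μ ≠ 0) :
    ∃ c t, 0 < t ∧ ∀ i, ∫ x, invStereographic c t x i ∂μ = 0 := by
  obtain ⟨⟨c, s⟩, hmin⟩ := exists_forall_conformalEnergy_le μ hK hμK hμ
  set t := Real.exp s with ht
  have t0 : 0 < t := Real.exp_pos s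
  have hts : Real.exp (2 * s) = t ^ 2 := by rw [two_mul, Real.exp_add, sq]
  set D : EuclideanSpace ℝ (Fin n) → ℝ := fun x => ‖x - c‖ ^ 2 + t ^ 2 with hD
  have D0 : ∀ x, 0 < D x := fun x => by positivity
  have hDc : Continuous D := by fun_prop
  have hint : ∀ f : EuclideanSpace ℝ (Fin n) → ℝ, Continuous f → Integrable f μ := fun f hf =>
    Continuous.integrable_of_restrict_eq μ hK hμK hf
  have hDi : Continuous fun x => (D x)⁻¹ := hDc.inv₀ fun x => (D0 x).ne'
  have hlog : ∀ (c' : EuclideanSpace ℝ (Fin n)) (s' : ℝ) (φ : EuclideanSpace ℝ (Fin n) → ℝ),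
      Continuous φ → (∀ x, ‖x - c'‖ ^ 2 + Real.exp (2 * s') = D x + φ x) →
      0 ≤ ∫ x, (φ x * (D x)⁻¹ - (s' - s)) ∂μ := by
    intro c' s' φ hφ h
    have hle := hmin (c', s')
    unfold conformalEnergy at hle
    rw [← sub_nonneg, ← integral_sub (integrable_conformalIntegrand μ hK hμK (c', s'))
      (integrable_conformalIntegrand μ hK hμK (c, s))] at hle
    refine hle.trans (integral_mono ((integrable_conformalIntegrand μ hK hμK (c', s')).sub
      (integrable_conformalIntegrand μ hK hμK (c, s))) (hint _ (by fun_prop)) fun x => ?_)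
    have hpos : 0 < D x + φ x := by rw [← h]; positivity
    have h1 := Real.log_le_sub_one_of_pos (div_pos hpos (D0 x))
    rw [Real.log_div hpos.ne' (D0 x).ne', add_div, div_self (D0 x).ne', div_eq_mul_inv] at h1
    simp only [h, hts]
    change Real.log (D x + φ x) - s' - (Real.log (D x) - s) ≤ _
    linarith
  refine ⟨c, t, t0, Fin.cases ?_ fun i => ?_⟩
  · have hder : ∀ h : ℝ, 0 ≤ (Real.exp (2 * h) - 1) * (∫ x, t ^ 2 * (D x)⁻¹ ∂μ) -
        μ.real Set.univ * h := by
      intro h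
      have := hlog c (s + h) (fun _ => (Real.exp (2 * h) - 1) * t ^ 2) (by fun_prop)
        (fun x => by rw [mul_add, Real.exp_add, hts]; simp only [hD]; ring)
      rw [integral_sub (hint _ (by fun_prop)) (integrable_const _), integral_const] at this
      simp only [mul_assoc, add_sub_cancel_left, smul_eq_mul] at this
      rwa [integral_const_mul] at this
    have hmin0 : IsLocalMin (fun h : ℝ => (Real.exp (2 * h) - 1) * (∫ x, t ^ 2 * (D x)⁻¹ ∂μ) -
        μ.real Set.univ * h) 0 := .of_forall fun h => by simpa using hder h
    have hd := hmin0.hasDerivAt_eq_zero (((((hasDerivAt_id (0 : ℝ)).const_mul 2).exp.sub_const 1).mul_const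
      _).sub ((hasDerivAt_id (0 : ℝ)).const_mul _))
    simp at hd
    calc ∫ x, invStereographic c t x 0 ∂μ
        = ∫ x, (2 * (t ^ 2 * (D x)⁻¹) - 1) ∂μ := by
          congr 1; ext x
          rw [invStereographic_zero, conformalFactor]
          change t * (2 * t / D x) - 1 = _
          ring
      _ = 0 := by
          rw [integral_sub (hint _ (by fun_prop)) (integrable_const _), integral_const,
            integral_const_mul]
          simpa using hd
  · have hder : ∀ h : ℝ, 0 ≤ h ^ 2 * (∫ x, (D x)⁻¹ ∂μ) -
        2 * (∫ x, (x i - c i) * (D x)⁻¹ ∂μ) * h := by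
      intro h
      have := hlog (c + h • EuclideanSpace.single i 1) s (fun x => h ^ 2 - 2 * h * (x i - c i))
        (by fun_prop) (fun x => by
          rw [← sub_sub, norm_sub_sq_real, hts, inner_smul_right, norm_smul,
            EuclideanSpace.inner_single_right]
          simp [hD]
          ring)
      simp only [sub_self, sub_zero, sub_mul] at this
      rw [integral_sub (hint _ (by fun_prop)) (hint _ (by fun_prop)), integral_const_mul] at this
      simp only [mul_assoc, integral_const_mul] at this ⊢
      linarith
    have hmin0 : IsLocalMin (fun h : ℝ => h ^ 2 * (∫ x, (D x)⁻¹ ∂μ) -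
        2 * (∫ x, (x i - c i) * (D x)⁻¹ ∂μ) * h) 0 := .of_forall fun h => by simpa using hder h
    have hd := hmin0.hasDerivAt_eq_zero (((hasDerivAt_pow 2 (0 : ℝ)).mul_const _).sub
      ((hasDerivAt_id (0 : ℝ)).const_mul _))
    simp at hd
    calc ∫ x, invStereographic c t x i.succ ∂μ
        = ∫ x, 2 * t * ((x i - c i) * (D x)⁻¹) ∂μ := by
          congr 1; ext x
          rw [invStereographic_succ, conformalFactor]
          change 2 * t / D x * _ = _
          ring
      _ = 0 := by rw [integral_const_mul, hd, mul_zero]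

end ConformalEnergy

section Gradient

variable {n : ℕ} (c : EuclideanSpace ℝ (Fin n)) {t : ℝ}

theorem hasFDerivAt_conformalFactor (ht : 0 < t) (x : EuclideanSpace ℝ (Fin n)) :
    HasFDerivAt (conformalFactor c t) (-(conformalFactor c t x ^ 2 / t) • innerSL ℝ (x - c)) x := by
  have hD : ‖x - c‖ ^ 2 + t ^ 2 ≠ 0 := by positivity
  have h := ((hasDerivAt_inv hD).comp_hasFDerivAt x
    ((((hasFDerivAt_id x).sub_const c).norm_sq).add_const (t ^ 2))).const_mul (2 * t)
  refine h.congr_fderiv ?_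
  ext v
  simp [conformalFactor]
  field_simp

theorem hasGradientAt_invStereographic_zero (ht : 0 < t) (x : EuclideanSpace ℝ (Fin n)) :
    HasGradientAt (fun x => invStereographic c t x 0) (-(conformalFactor c t x ^ 2) • (x - c)) x := by
  rw [hasGradientAt_iff_hasFDerivAt]
  refine (((hasFDerivAt_conformalFactor c ht x).const_mul t).sub_const 1).congr_fderiv ?_
  ext v
  simp
  field_simp

theorem hasGradientAt_invStereographic_succ (ht : 0 < t) (x : EuclideanSpace ℝ (Fin n))
    (i : Fin n) :
    HasGradientAt (fun x => invStereographic c t x i.succ)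
      (conformalFactor c t x • EuclideanSpace.single i 1 -
        (conformalFactor c t x ^ 2 / t * (x i - c i)) • (x - c)) x := by
  rw [hasGradientAt_iff_hasFDerivAt]
  have h := (hasFDerivAt_conformalFactor c ht x).mul
    (((EuclideanSpace.proj (𝕜 := ℝ) i).hasFDerivAt (x := x)).sub_const (c i))
  refine h.congr_fderiv ?_
  ext v
  simp [EuclideanSpace.inner_single_left]
  ring

theorem contDiff_invStereographic_apply (ht : 0 < t) {k : WithTop ℕ∞} (i : Fin (n + 1)) :
    ContDiff ℝ k fun x => invStereographic c t x i := by
  have h := contDiff_conformalFactor c ht (k := k)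
  refine Fin.cases ?_ (fun i => ?_) i
  · simp only [invStereographic_zero]
    fun_prop
  · simp only [invStereographic_succ]
    fun_prop

theorem sum_norm_gradient_invStereographic_sq (ht : 0 < t) (x : EuclideanSpace ℝ (Fin n)) :
    ∑ i, ‖gradient (fun x => invStereographic c t x i) x‖ ^ 2 = n * conformalFactor c t x ^ 2 := by
  rw [Fin.sum_univ_succ, (hasGradientAt_invStereographic_zero c ht x).gradient]
  simp only [(hasGradientAt_invStereographic_succ c ht x _).gradient]
  have h := conformalFactor_mul c ht x
  set l := conformalFactor c t x
  have hs : ∀ i, ‖l • EuclideanSpace.single i (1 : ℝ) - (l ^ 2 / t * (x i - c i)) • (x - c)‖ ^ 2 =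
      l ^ 2 + (x i - c i) ^ 2 * (l ^ 4 / t ^ 2 * ‖x - c‖ ^ 2 - 2 * l ^ 3 / t) := by
    intro i
    rw [norm_sub_sq_real, norm_smul, norm_smul, inner_smul_left, inner_smul_right,
      EuclideanSpace.inner_single_left, mul_pow, mul_pow, Real.norm_eq_abs, Real.norm_eq_abs,
      sq_abs, sq_abs]
    simp
    ring
  have hx : ∑ i, (x i - c i) ^ 2 = ‖x - c‖ ^ 2 := by simp [EuclideanSpace.norm_sq_eq]
  rw [Finset.sum_congr rfl fun i _ => hs i, Finset.sum_add_distrib, ← Finset.sum_mul, hx,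
    norm_smul, mul_pow, Real.norm_eq_abs, sq_abs]
  simp
  field_simp
  linear_combination (l ^ 3 * ‖x - c‖ ^ 2) * h

end Gradient

theorem stekSigma1_mul_integral_sq_le {n : ℕ} (Ω : Set (EuclideanSpace ℝ (Fin n)))
    {f : EuclideanSpace ℝ (Fin n) → ℝ} (hf : ContDiff ℝ (⊤ : ℕ∞) f)
    (hf0 : ∫ x in frontier Ω, f x ∂(μH[(n : ℝ) - 1]) = 0) :
    stekSigma1 Ω * ∫ x in frontier Ω, f x ^ 2 ∂(μH[(n : ℝ) - 1]) ≤
      ∫ x in Ω, ‖gradient f x‖ ^ 2 := by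
  have h0 : 0 ≤ ∫ x in frontier Ω, f x ^ 2 ∂(μH[(n : ℝ) - 1]) :=
    integral_nonneg fun x => sq_nonneg _
  rcases h0.eq_or_lt with h | h
  · rw [← h, mul_zero]
    exact integral_nonneg fun x => sq_nonneg _
  · rw [← le_div_iff₀ h]
    refine csInf_le ⟨0, ?_⟩ ⟨f, hf, hf0, h, rfl⟩
    rintro _ ⟨g, -, -, hg, rfl⟩
    exact div_nonneg (integral_nonneg fun x => sq_nonneg _) hg.le

theorem steklov_bound_of_isoperimetric {n σ H V S w : ℝ} (hn : 2 ≤ n) (hH : 0 < H) (hV : 0 ≤ V)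
    (hS : 0 ≤ S) (hw : 0 < w) (h : σ * H ≤ n * (S ^ (2 / n) * V ^ ((n - 2) / n)))
    (iso : n * w ^ n⁻¹ * V ^ ((n - 1) / n) ≤ H) :
    σ * H ^ (1 / (n - 1)) ≤ n ^ (1 / (n - 1)) * S ^ (2 / n) / w ^ ((n - 2) / (n * (n - 1))) := by
  have n0 : 0 < n := by linarith
  have n1 : 0 < n - 1 := by linarith
  set e := (n - 2) / (n - 1) with he
  have e0 : 0 ≤ e := div_nonneg (by linarith) n1.le
  have he1 : 1 / (n - 1) = 1 - e := by rw [he]; field_simp; ring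
  have hiso : n ^ e * w ^ ((n - 2) / (n * (n - 1))) * V ^ ((n - 2) / n) ≤ H ^ e := by
    have := Real.rpow_le_rpow (by positivity) iso e0
    rw [Real.mul_rpow (by positivity) (by positivity), Real.mul_rpow (by positivity)
      (by positivity), ← Real.rpow_mul hw.le, ← Real.rpow_mul hV] at this
    convert this using 3
    · congr 1
      rw [he]; field_simp
    · rw [he]; field_simp
  rw [he1, le_div_iff₀ (by positivity), Real.rpow_sub hH, Real.rpow_sub n0, Real.rpow_one,
    Real.rpow_one]
  have hHe : 0 < H ^ e := by positivity
  have hne : 0 < n ^ e := by positivity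
  set W := w ^ ((n - 2) / (n * (n - 1)))
  have hW : 0 < W := by positivity
  calc σ * (H / H ^ e) * W = σ * H * (W / H ^ e) := by ring
    _ ≤ n * (S ^ (2 / n) * V ^ ((n - 2) / n)) * (W / H ^ e) := by gcongr
    _ = n / n ^ e * S ^ (2 / n) * (n ^ e * W * V ^ ((n - 2) / n) / H ^ e) := by
        field_simp
    _ ≤ n / n ^ e * S ^ (2 / n) * 1 := by
        gcongr
        exact (div_le_one hHe).2 hiso
    _ = _ := by ring

theorem lintegral_sq_le_rpow {α : Type*} [MeasurableSpace α] (μ : Measure α) {n : ℕ} (hn : 2 ≤ n)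
    {f : α → ℝ≥0∞} (hf : AEMeasurable f μ) :
    ∫⁻ x, f x ^ 2 ∂μ ≤ (∫⁻ x, f x ^ n ∂μ) ^ (2 / n : ℝ) * μ Set.univ ^ (((n : ℝ) - 2) / n) := by
  have n0 : (n : ℝ) ≠ 0 := by positivity
  have h := eLpNorm'_le_eLpNorm'_mul_rpow_measure_univ (p := 2) (q := n) (f := f) two_pos
    (by exact_mod_cast hn) hf.aestronglyMeasurable
  have h2 := ENNReal.rpow_le_rpow h (zero_le_two (α := ℝ))
  simp only [eLpNorm', enorm_eq_self, ENNReal.rpow_natCast] at h2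
  rw [ENNReal.mul_rpow_of_nonneg _ _ zero_le_two, ← ENNReal.rpow_mul, ← ENNReal.rpow_mul,
    ← ENNReal.rpow_mul] at h2
  convert! h2 using 2
  · simp
  · congr 1; ring
  · congr 1; field_simp

/-- The estimate on `stekSigma1` obtained from the coordinates of the inverse stereographic
projection that centres the boundary measure. -/
theorem stekSigma1_mul_hausdorffMeasure_le {n : ℕ} (hn : 2 ≤ n) (Ω : Set (EuclideanSpace ℝ (Fin n)))
    (hΩb : Bornology.IsBounded Ω)
    (h0 : 0 < μH[(n : ℝ) - 1] (frontier Ω)) (hfin : μH[(n : ℝ) - 1] (frontier Ω) < ⊤) :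
    stekSigma1 Ω * (μH[(n : ℝ) - 1] (frontier Ω)).toReal ≤
      n * ((μH[(n : ℝ)] {y : EuclideanSpace ℝ (Fin (n + 1)) | ‖y‖ = 1}).toReal ^ (2 / n : ℝ) *
        (volume Ω).toReal ^ (((n : ℝ) - 2) / n)) := by
  have hn' : (2 : ℝ) ≤ n := by exact_mod_cast hn
  set K := frontier Ω with hKdef
  have hK : IsCompact K := hΩb.isCompact_closure.of_isClosed_subset isClosed_frontier
    frontier_subset_closure
  have hnull := Measure.nullSingletonClass_hausdorff (EuclideanSpace ℝ (Fin n))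
    (by linarith : 0 < (n : ℝ) - 1)
  set μ := (μH[(n : ℝ) - 1] : Measure (EuclideanSpace ℝ (Fin n))).restrict K with hμ
  have : IsFiniteMeasure μ := ⟨by simpa [hμ] using hfin⟩
  have hμK : μ.restrict K = μ := by rw [hμ, Measure.restrict_restrict_of_subset subset_rfl]
  have hμ0 : μ ≠ 0 := by
    rw [hμ, Ne, Measure.restrict_eq_zero]; exact h0.ne'
  obtain ⟨c, t, ht, hct⟩ := exists_integral_invStereographic_eq_zero μ hK hμK hμ0
  have hlc : Continuous (conformalFactor c t) := (contDiff_conformalFactor c ht (k := 0)).continuous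
  have hf : ∀ i, ContDiff ℝ (⊤ : ℕ∞) fun x => invStereographic c t x i := fun i =>
    contDiff_invStereographic_apply c ht i
  have hintΩ : ∀ g : EuclideanSpace ℝ (Fin n) → ℝ, Continuous g → IntegrableOn g Ω := fun g hg =>
    (hg.continuousOn.integrableOn_compact hΩb.isCompact_closure).mono_set subset_closure
  have hgrad : ∀ i, Continuous fun x =>
      ‖gradient (fun x => invStereographic c t x i) x‖ ^ 2 := fun i =>
    ((((InnerProductSpace.toDual ℝ (EuclideanSpace ℝ (Fin n))).symm.continuous).comp
      ((hf i).continuous_fderiv (by simp))).norm).pow 2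
  have hsum : ∑ i, ∫ x, invStereographic c t x i ^ 2 ∂μ = (μH[(n : ℝ) - 1] K).toReal := by
    have hint : ∀ i, Integrable (fun x => invStereographic c t x i ^ 2) μ := fun i =>
      Continuous.integrable_of_restrict_eq μ hK hμK ((hf i).continuous.pow 2)
    rw [← integral_finsetSum _ fun i _ => hint i]
    have : ∀ x, ∑ i, invStereographic c t x i ^ 2 = 1 := fun x => by
      have := EuclideanSpace.norm_sq_eq (invStereographic c t x)
      rw [norm_invStereographic c ht] at this
      simpa using this.symm
    simp [this, hμ, Measure.real]
  have hI : ∫ x in Ω, conformalFactor c t x ^ 2 ≤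
      (μH[(n : ℝ)] {y : EuclideanSpace ℝ (Fin (n + 1)) | ‖y‖ = 1}).toReal ^ (2 / n : ℝ) *
        (volume Ω).toReal ^ (((n : ℝ) - 2) / n) := by
    rw [ENNReal.toReal_rpow, ENNReal.toReal_rpow, ← ENNReal.toReal_mul,
      integral_eq_lintegral_of_nonneg_ae (.of_forall fun x => sq_nonneg _)
        (hlc.pow 2).aestronglyMeasurable]
    refine ENNReal.toReal_mono (ENNReal.mul_ne_top ?_ ?_) ?_
    · exact ENNReal.rpow_ne_top_of_nonneg (by positivity) (hausdorffMeasure_unitSphere_lt_top n).ne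
    · exact ENNReal.rpow_ne_top_of_nonneg (div_nonneg (by linarith) (by positivity))
        hΩb.measure_lt_top.ne
    · have := lintegral_sq_le_rpow (volume.restrict Ω) hn
        (f := fun x => ENNReal.ofReal (conformalFactor c t x)) (by fun_prop)
      rw [Measure.restrict_apply_univ] at this
      simp only [ENNReal.ofReal_pow (conformalFactor_pos c ht _).le]
      refine this.trans ?_
      gcongr
      exact (setLIntegral_le_lintegral _ _).trans (lintegral_conformalFactor_pow_le c ht)
  calc stekSigma1 Ω * (μH[(n : ℝ) - 1] K).toReal
      = ∑ i, stekSigma1 Ω * ∫ x, invStereographic c t x i ^ 2 ∂μ := by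
        rw [← hsum, Finset.mul_sum]
    _ ≤ ∑ i, ∫ x in Ω, ‖gradient (fun x => invStereographic c t x i) x‖ ^ 2 :=
        Finset.sum_le_sum fun i _ => stekSigma1_mul_integral_sq_le Ω (hf i) (hct i)
    _ = ∫ x in Ω, n * conformalFactor c t x ^ 2 := by
        rw [← integral_finsetSum _ fun i _ => hintΩ _ (hgrad i)]
        simp only [sum_norm_gradient_invStereographic_sq c ht]
    _ ≤ _ := by
        rw [integral_const_mul]
        gcongr

/-- Proposition 2.1: explicit upper bound for the normalized first Steklov eigenvalue of a
bounded domain in `ℝⁿ`. -/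
theorem stmt0 {n : ℕ} (hn : 2 ≤ n) (Ω : Set (EuclideanSpace ℝ (Fin n)))
    (hΩo : IsOpen Ω) (hΩb : Bornology.IsBounded Ω) (hΩne : Ω.Nonempty)
    (h0 : 0 < μH[(n : ℝ) - 1] (frontier Ω))
    (hfin : μH[(n : ℝ) - 1] (frontier Ω) < ⊤) :
    stekSigma1 Ω * (μH[(n : ℝ) - 1] (frontier Ω)).toReal ^ ((1 : ℝ) / ((n : ℝ) - 1)) ≤
      (n : ℝ) ^ ((1 : ℝ) / ((n : ℝ) - 1)) *
        ((μH[(n : ℝ)] {y : EuclideanSpace ℝ (Fin (n + 1)) | ‖y‖ = 1}).toReal) ^ ((2 : ℝ) / (n : ℝ)) /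
        ((volume (Metric.ball (0 : EuclideanSpace ℝ (Fin n)) 1)).toReal) ^
          (((n : ℝ) - 2) / ((n : ℝ) * ((n : ℝ) - 1))) := by
  refine steklov_bound_of_isoperimetric (by exact_mod_cast hn) (ENNReal.toReal_pos h0.ne' hfin.ne)
    ENNReal.toReal_nonneg ENNReal.toReal_nonneg
    (ENNReal.toReal_pos (Metric.measure_ball_pos volume _ one_pos).ne' measure_ball_lt_top.ne)
    (stekSigma1_mul_hausdorffMeasure_le hn Ω hΩb h0 hfin) ?_
  obtain ⟨m, rfl⟩ : ∃ m, n = m + 1 := ⟨n - 1, by omega⟩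
  have hm : ((m + 1 : ℕ) : ℝ) - 1 = m := by push_cast; ring
  have iso := EuclideanSpace.isoperimetric (by omega : 0 < m) hΩo hΩb
  rw [← hm] at iso
  have := ENNReal.toReal_mono hfin.ne iso
  rwa [ENNReal.toReal_mul, ENNReal.toReal_mul, ← ENNReal.toReal_rpow, ← ENNReal.toReal_rpow,
    ENNReal.toReal_ofReal (by positivity)] at this
end

section
/- Let n ≥ 2 and let Ω ⊆ ℝⁿ be a bounded nonempty open set whose frontier ∂Ω satisfies 0 < H^{n−1}(∂Ω) < ∞, and let μ be the measure H^{n−1} restricted to ∂Ω. Then there exists an injective C^∞ map F : ℝⁿ → ℝ^{n+1} such that ‖F(x)‖ = 1 for every x ∈ ℝⁿ, F is conformal at every point of ℝⁿ (its derivative at each point is a nonzero scalar multiple of a linear isometry), and ∫ F dμ = 0 ∈ ℝ^{n+1}. -/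
open MeasureTheory

section ConformalBarycenter

variable {E : Type*} [NormedAddCommGroup E]

lemma norm_sub_sq_add_exp_pos (p : E × ℝ) (x : E) : 0 < ‖x - p.1‖ ^ 2 + Real.exp p.2 := by
  positivity

/-- The Busemann function of the upper half-space model of hyperbolic space based at the boundary
point `x`, evaluated at the point with horizontal coordinate `p.1` and squared height
`exp p.2`. -/
noncomputable def halfSpaceBusemann (p : E × ℝ) (x : E) : ℝ :=
  Real.log (‖x - p.1‖ ^ 2 + Real.exp p.2) - p.2 / 2

lemma continuous_halfSpaceBusemann :
    Continuous (Function.uncurry (halfSpaceBusemann : E × ℝ → E → ℝ)) := by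
  unfold halfSpaceBusemann
  refine Continuous.sub (Continuous.log (by fun_prop) ?_) (by fun_prop)
  exact fun q => (norm_sub_sq_add_exp_pos q.1 q.2).ne'

lemma half_le_halfSpaceBusemann (p : E × ℝ) (x : E) : p.2 / 2 ≤ halfSpaceBusemann p x := by
  have h : Real.log (Real.exp p.2) ≤ Real.log (‖x - p.1‖ ^ 2 + Real.exp p.2) :=
    Real.log_le_log (Real.exp_pos _) (by nlinarith [sq_nonneg ‖x - p.1‖])
  rw [Real.log_exp] at h
  unfold halfSpaceBusemann
  linarith

lemma two_mul_log_sub_le_halfSpaceBusemann (p : E × ℝ) {x : E} {r : ℝ} (hr : 0 < r)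
    (h : r ≤ ‖x - p.1‖) : 2 * Real.log r - p.2 / 2 ≤ halfSpaceBusemann p x := by
  have h1 : Real.log (r ^ 2) ≤ Real.log (‖x - p.1‖ ^ 2 + Real.exp p.2) :=
    Real.log_le_log (by positivity) (by nlinarith [Real.exp_pos p.2])
  rw [Real.log_pow] at h1
  push_cast at h1
  unfold halfSpaceBusemann
  linarith

variable [MeasurableSpace E] [BorelSpace E]

/-- A measure without atoms carried by a compact set gives uniformly small mass to all balls of
some fixed radius. -/
lemma exists_forall_measureReal_ball_le {μ : Measure E} [IsFiniteMeasure μ] {K : Set E}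
    (hK : IsCompact K) (hμK : ∀ᵐ x ∂μ, x ∈ K) (hμ : ∀ x, μ {x} = 0) {c : ℝ} (hc : 0 < c) :
    ∃ δ > 0, δ ≤ 1 ∧ ∀ a, μ.real (Metric.ball a δ) ≤ c := by
  have h1 : ∀ x : E, ∃ U ⊇ ({x} : Set E), IsOpen U ∧ μ U < ENNReal.ofReal c := fun x =>
    Set.exists_isOpen_lt_of_lt {x} _ (by simpa [hμ x] using hc)
  choose U hxU hUo hUc using h1
  obtain ⟨δ, hδ, hball⟩ := lebesgue_number_lemma_of_metric hK hUo
    (fun x _ => Set.mem_iUnion.2 ⟨x, hxU x rfl⟩)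
  refine ⟨min (δ / 2) 1, by positivity, min_le_right _ _, fun a => ?_⟩
  have hle : min (δ / 2) 1 ≤ δ / 2 := min_le_left _ _
  by_cases hne : ∃ x ∈ K, x ∈ Metric.ball a (min (δ / 2) 1)
  · obtain ⟨x, hxK, hx⟩ := hne
    obtain ⟨i, hi⟩ := hball x hxK
    have hsub : Metric.ball a (min (δ / 2) 1) ⊆ U i := by
      refine (Metric.ball_subset_ball' ?_).trans hi
      rw [Metric.mem_ball, dist_comm] at hx
      linarith
    exact ENNReal.toReal_le_of_le_ofReal hc.le ((measure_mono hsub).trans (hUc i).le)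
  · push Not at hne
    have h0 : μ (Metric.ball a (min (δ / 2) 1)) = 0 :=
      measure_mono_null (fun x hx hxK => hne x hxK hx) hμK
    simpa [Measure.real, h0] using hc.le

lemma Continuous.integrable_of_ae_mem_isCompact {G : Type*} [NormedAddCommGroup G] {μ : Measure E}
    [IsFiniteMeasure μ] {K : Set E} (hK : IsCompact K) (hμK : ∀ᵐ x ∂μ, x ∈ K) {g : E → G}
    (hg : Continuous g) : Integrable g μ := by
  have h := hg.continuousOn.integrableOn_compact (μ := μ) hK
  rwa [IntegrableOn, Measure.restrict_eq_self_of_ae_mem hμK] at h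

lemma eq_zero_of_forall_nonneg_linear_add_sq {b c ε : ℝ} (hε : 0 < ε)
    (h : ∀ r, |r| < ε → 0 ≤ r * b + r ^ 2 * c) : b = 0 := by
  have hmin : IsLocalMin (fun r : ℝ => r * b + r ^ 2 * c) 0 := by
    filter_upwards [Metric.ball_mem_nhds (0 : ℝ) hε] with r hr
    simpa using h r (by simpa using hr)
  have hd : HasDerivAt (fun r : ℝ => r * b + r ^ 2 * c) b 0 := by
    refine HasDerivAt.congr_deriv (((hasDerivAt_id' (0 : ℝ)).mul_const b).add
      (((hasDerivAt_id' (0 : ℝ)).pow 2).mul_const c)) ?_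
    simp
  exact hmin.hasDerivAt_eq_zero hd

lemma exists_forall_norm_le_of_integral_halfSpaceBusemann_le {μ : Measure E} [IsFiniteMeasure μ]
    [NeZero μ] {K : Set E} (hK : IsCompact K) (hμK : ∀ᵐ x ∂μ, x ∈ K) (hμ : ∀ x, μ {x} = 0)
    (C : ℝ) :
    ∃ r, ∀ p : E × ℝ, ∫ x, halfSpaceBusemann p x ∂μ ≤ C → ‖p‖ ≤ r := by
  have hint (p : E × ℝ) : Integrable (halfSpaceBusemann p) μ :=
    Continuous.integrable_of_ae_mem_isCompact hK hμK
      (continuous_halfSpaceBusemann.comp (Continuous.prodMk_right p))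
  set M := μ.real Set.univ with hM
  have hM0 : 0 < M := measureReal_univ_pos
  obtain ⟨δ, hδ, hδ1, hball⟩ :=
    exists_forall_measureReal_ball_le hK hμK hμ (c := M / 4) (by positivity)
  obtain ⟨R, hR⟩ := hK.isBounded.exists_norm_le
  have hl : Real.log δ ≤ 0 := Real.log_nonpos hδ.le hδ1
  have hupper (p : E × ℝ) : M * (p.2 / 2) ≤ ∫ x, halfSpaceBusemann p x ∂μ := by
    have h := integral_mono (integrable_const (p.2 / 2)) (hint p) (half_le_halfSpaceBusemann p)
    simpa using h
  have hlower (p : E × ℝ) (hp : p.2 ≤ 0) :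
      2 * Real.log δ * M - p.2 * M / 4 ≤ ∫ x, halfSpaceBusemann p x ∂μ := by
    have hmeas : MeasurableSet (Metric.ball p.1 δ)ᶜ := measurableSet_ball.compl
    have hind : Integrable
        ((Metric.ball p.1 δ)ᶜ.indicator fun _ : E => 2 * Real.log δ - p.2) μ :=
      (integrable_const _).indicator hmeas
    have h := integral_mono ((integrable_const (p.2 / 2)).add hind) (hint p) (fun x => by
      by_cases hx : x ∈ (Metric.ball p.1 δ)ᶜ
      · simp only [Pi.add_apply, Set.indicator_of_mem hx]
        have := two_mul_log_sub_le_halfSpaceBusemann p (x := x) hδ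
          (by simpa [dist_eq_norm] using hx)
        linarith
      · simp only [Pi.add_apply, Set.indicator_of_notMem hx, add_zero]
        exact half_le_halfSpaceBusemann p x)
    simp only [Pi.add_apply] at h
    rw [integral_add (integrable_const _) hind, integral_indicator_const _ hmeas,
      integral_const, measureReal_compl measurableSet_ball] at h
    simp only [smul_eq_mul] at h
    rw [← hM] at h
    have hb := hball p.1
    have hb0 : 0 ≤ μ.real (Metric.ball p.1 δ) := measureReal_nonneg
    nlinarith [mul_nonneg hb0 (neg_nonneg.2 hl),
      mul_nonneg (sub_nonneg.2 hb) (neg_nonneg.2 hp)]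
  have hfar (p : E × ℝ) (B : ℝ) (hB : R + Real.exp B ≤ ‖p.1‖) :
      M * (2 * B - p.2 / 2) ≤ ∫ x, halfSpaceBusemann p x ∂μ := by
    have h := integral_mono_ae (integrable_const (2 * B - p.2 / 2)) (hint p) (by
      filter_upwards [hμK] with x hx
      have h1 : Real.exp B ≤ ‖x - p.1‖ := by
        have := norm_sub_norm_le p.1 x
        rw [norm_sub_rev] at this
        linarith [hR x hx]
      simpa using two_mul_log_sub_le_halfSpaceBusemann p (Real.exp_pos B) h1)
    simpa using h
  set U := max (2 * C / M) (max 0 (4 * C / M - 8 * Real.log δ)) with hU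
  set B := (C / M + U / 2 + 1) / 2 with hBdef
  refine ⟨max (R + Real.exp B) U, fun p hp => ?_⟩
  have hu1 : p.2 ≤ U := by
    refine le_trans ?_ (le_max_left _ _)
    rw [le_div_iff₀ hM0]
    linarith [hupper p]
  have hu2 : -U ≤ p.2 := by
    by_cases h0 : p.2 ≤ 0
    · have h1 : -p.2 ≤ 4 * C / M - 8 * Real.log δ := by
        have h2 : -p.2 + 8 * Real.log δ ≤ 4 * C / M := by
          rw [le_div_iff₀ hM0]
          linarith [hlower p h0]
        linarith
      linarith [h1.trans ((le_max_right 0 _).trans (le_max_right (2 * C / M) _))]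
    · linarith [(le_max_left 0 (4 * C / M - 8 * Real.log δ)).trans (le_max_right (2 * C / M) _)]
  have ha : ‖p.1‖ ≤ R + Real.exp B := by
    by_contra! h
    have h1 := hfar p B h.le
    have h2 : M * (C / M + 1) ≤ M * (2 * B - p.2 / 2) :=
      mul_le_mul_of_nonneg_left (by linarith) hM0.le
    have h3 : M * (C / M + 1) = C + M := by field_simp
    linarith
  rw [Prod.norm_def]
  exact max_le_max ha (abs_le.2 ⟨hu2, hu1⟩)

variable [InnerProductSpace ℝ E] [FiniteDimensional ℝ E]

lemma exists_forall_integral_halfSpaceBusemann_le {μ : Measure E} [IsFiniteMeasure μ]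
    [NeZero μ] {K : Set E} (hK : IsCompact K) (hμK : ∀ᵐ x ∂μ, x ∈ K) (hμ : ∀ x, μ {x} = 0) :
    ∃ p : E × ℝ, ∀ q : E × ℝ,
      ∫ x, halfSpaceBusemann p x ∂μ ≤ ∫ x, halfSpaceBusemann q x ∂μ := by
  have hcont : Continuous fun p : E × ℝ => ∫ x, halfSpaceBusemann p x ∂μ := by
    have h := continuous_parametric_integral_of_continuous (μ := μ)
      (continuous_halfSpaceBusemann (E := E)) hK
    rwa [Measure.restrict_eq_self_of_ae_mem hμK] at h
  obtain ⟨r, hr⟩ := exists_forall_norm_le_of_integral_halfSpaceBusemann_le hK hμK hμ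
    (∫ x, halfSpaceBusemann (0 : E × ℝ) x ∂μ)
  refine hcont.exists_forall_le' 0 ?_
  filter_upwards [(tendsto_norm_cocompact_atTop (E := E × ℝ)).eventually_gt_atTop r] with q hq
  by_contra! h
  exact (hr q h.le).not_gt hq

/-- Euler–Lagrange equations of the averaged Busemann function. -/
lemma integral_eq_of_forall_integral_halfSpaceBusemann_le {μ : Measure E} [IsFiniteMeasure μ]
    {K : Set E} (hK : IsCompact K) (hμK : ∀ᵐ x ∂μ, x ∈ K) {p : E × ℝ}
    (hp : ∀ q : E × ℝ, ∫ x, halfSpaceBusemann p x ∂μ ≤ ∫ x, halfSpaceBusemann q x ∂μ) :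
    ∫ x, (‖x - p.1‖ ^ 2 + Real.exp p.2)⁻¹ • (x - p.1) ∂μ = 0 ∧
      ∫ x, Real.exp p.2 / (‖x - p.1‖ ^ 2 + Real.exp p.2) ∂μ = μ.real Set.univ / 2 := by
  have hD (x : E) : 0 < ‖x - p.1‖ ^ 2 + Real.exp p.2 := norm_sub_sq_add_exp_pos p x
  have hint {g : E → ℝ} (hg : Continuous g) : Integrable g μ := Continuous.integrable_of_ae_mem_isCompact hK hμK hg
  have hintB (q : E × ℝ) : Integrable (halfSpaceBusemann q) μ :=
    Continuous.integrable_of_ae_mem_isCompact hK hμK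
      (continuous_halfSpaceBusemann.comp (Continuous.prodMk_right q))
  have hinv : Continuous fun x : E => (‖x - p.1‖ ^ 2 + Real.exp p.2)⁻¹ :=
    Continuous.inv₀ (by fun_prop) fun x => (hD x).ne'
  have hvar (q : E × ℝ) : 0 ≤ ∫ x, (halfSpaceBusemann q x - halfSpaceBusemann p x) ∂μ := by
    rw [integral_sub (hintB q) (hintB p)]
    linarith [hp q]
  have hlog (q : E × ℝ) (x : E) : halfSpaceBusemann q x - halfSpaceBusemann p x ≤
      (‖x - q.1‖ ^ 2 + Real.exp q.2 - (‖x - p.1‖ ^ 2 + Real.exp p.2)) *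
        (‖x - p.1‖ ^ 2 + Real.exp p.2)⁻¹ - (q.2 - p.2) / 2 := by
    have h := Real.log_le_sub_one_of_pos (div_pos (norm_sub_sq_add_exp_pos q x) (hD x))
    rw [Real.log_div (norm_sub_sq_add_exp_pos q x).ne' (hD x).ne', div_eq_mul_inv] at h
    have h1 := mul_inv_cancel₀ (hD x).ne'
    unfold halfSpaceBusemann
    rw [sub_mul, h1]
    linarith
  have hintV : Integrable (fun x : E => (‖x - p.1‖ ^ 2 + Real.exp p.2)⁻¹ • (x - p.1)) μ :=
    Continuous.integrable_of_ae_mem_isCompact hK hμK (by fun_prop)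
  have hcd : Continuous fun x : E => x - p.1 := by fun_prop
  constructor
  · refine ext_inner_left ℝ fun v => ?_
    rw [inner_zero_right, ← integral_inner hintV]
    set b := ∫ x, inner ℝ v ((‖x - p.1‖ ^ 2 + Real.exp p.2)⁻¹ • (x - p.1)) ∂μ with hb
    set c := ∫ x, ‖v‖ ^ 2 * (‖x - p.1‖ ^ 2 + Real.exp p.2)⁻¹ ∂μ with hc
    have h := eq_zero_of_forall_nonneg_linear_add_sq (b := -2 * b) (c := c) one_pos
      fun r _ => ?_
    · linarith
    have hi1 : Integrable
        (fun x : E => inner ℝ v ((‖x - p.1‖ ^ 2 + Real.exp p.2)⁻¹ • (x - p.1))) μ :=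
      hint (continuous_const.inner (hinv.smul hcd))
    have hi2 : Integrable (fun x : E => ‖v‖ ^ 2 * (‖x - p.1‖ ^ 2 + Real.exp p.2)⁻¹) μ :=
      hint (continuous_const.mul hinv)
    have hmono := integral_mono ((hintB (p.1 + r • v, p.2)).sub (hintB p))
      ((hi1.const_mul (-2 * r)).add (hi2.const_mul (r ^ 2))) (fun x => by
        refine (hlog (p.1 + r • v, p.2) x).trans (le_of_eq ?_)
        have hexp : ‖x - (p.1 + r • v)‖ ^ 2 =
            ‖x - p.1‖ ^ 2 - 2 * (r * inner ℝ v (x - p.1)) + r ^ 2 * ‖v‖ ^ 2 := by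
          rw [← sub_sub, norm_sub_sq_real, inner_smul_right, norm_smul, mul_pow,
            Real.norm_eq_abs, sq_abs, real_inner_comm]
        simp only [Pi.add_apply, inner_smul_right, hexp]
        ring)
    have h0 := (hvar (p.1 + r • v, p.2)).trans hmono
    simp only [Pi.add_apply] at h0
    rw [integral_add (hi1.const_mul _) (hi2.const_mul _), integral_const_mul,
      integral_const_mul] at h0
    linarith
  · simp only [div_eq_mul_inv]
    set Q := ∫ x, Real.exp p.2 * (‖x - p.1‖ ^ 2 + Real.exp p.2)⁻¹ ∂μ with hQ
    set M := μ.real Set.univ with hM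
    have hM0 : 0 ≤ M := measureReal_nonneg
    have h := eq_zero_of_forall_nonneg_linear_add_sq (b := Q - M / 2) (c := M)
      (ε := 1 / 2) (by norm_num) fun r hr => ?_
    · linarith
    have hr1 := abs_lt.1 hr
    have hr0 : 0 < 1 + r := by linarith
    have hi : Integrable (fun x : E => Real.exp p.2 * (‖x - p.1‖ ^ 2 + Real.exp p.2)⁻¹) μ :=
      hint (continuous_const.mul hinv)
    have hmono := integral_mono ((hintB (p.1, p.2 + Real.log (1 + r))).sub (hintB p))
      ((hi.const_mul r).sub (integrable_const (Real.log (1 + r) / 2))) (fun x => by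
        refine (hlog (p.1, p.2 + Real.log (1 + r)) x).trans (le_of_eq ?_)
        simp only [Pi.sub_apply, Real.exp_add, Real.exp_log hr0]
        ring)
    have h0 := (hvar (p.1, p.2 + Real.log (1 + r))).trans hmono
    simp only [Pi.sub_apply] at h0
    rw [integral_sub (hi.const_mul _) (integrable_const _), integral_const_mul,
      integral_const, smul_eq_mul] at h0
    have hl := Real.one_sub_inv_le_log_of_pos hr0
    have hinv2 : r - 2 * r ^ 2 ≤ 1 - (1 + r)⁻¹ := by
      have : 1 - (1 + r)⁻¹ = r / (1 + r) := by field_simp; ring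
      rw [this, le_div_iff₀ hr0]
      nlinarith [mul_nonneg (sq_nonneg r) (by linarith : 0 ≤ 1 + 2 * r)]
    nlinarith [mul_le_mul_of_nonneg_left (hinv2.trans hl) hM0]

end ConformalBarycenter

section InverseStereographic

open EuclideanGeometry

variable {E G : Type*} [NormedAddCommGroup E] [InnerProductSpace ℝ E]
  [NormedAddCommGroup G] [InnerProductSpace ℝ G]

/-- Inverse stereographic projection from the pole `e`, along the isometric embedding `J` onto a
subspace orthogonal to `e`, precomposed with the similarity `x ↦ t⁻¹ • (x - a)`. -/
noncomputable def scaledStereoInv (J : E →ₗᵢ[ℝ] G) (e : G) (a : E) (t : ℝ) (x : E) : G :=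
  inversion e (√2) (J (t⁻¹ • (x - a)))

variable {J : E →ₗᵢ[ℝ] G} {e : G} {a : E} {t : ℝ}

lemma dist_sq_linearIsometry_pole (he : ‖e‖ = 1) (hJ : ∀ y, inner ℝ e (J y) = 0) (y : E) :
    dist (J y) e ^ 2 = ‖y‖ ^ 2 + 1 := by
  rw [dist_eq_norm, norm_sub_sq_real, real_inner_comm, hJ, he, J.norm_map]
  ring

lemma linearIsometry_ne_pole (he : ‖e‖ = 1) (hJ : ∀ y, inner ℝ e (J y) = 0) (y : E) : J y ≠ e := by
  rw [← dist_ne_zero]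
  intro h
  have := dist_sq_linearIsometry_pole he hJ y
  rw [h] at this
  nlinarith [sq_nonneg ‖y‖]

lemma scaledStereoInv_injective (ht : t ≠ 0) : Function.Injective (scaledStereoInv J e a t) := by
  intro x y h
  have h1 := J.injective (inversion_injective e (by positivity) h)
  exact sub_left_injective (smul_right_injective E (inv_ne_zero ht) h1)

lemma contDiff_scaledStereoInv (he : ‖e‖ = 1) (hJ : ∀ y, inner ℝ e (J y) = 0) :
    ContDiff ℝ (⊤ : ℕ∞) (scaledStereoInv J e a t) := by
  refine ContDiff.inversion contDiff_const contDiff_const ?_ fun x => linearIsometry_ne_pole he hJ _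
  exact J.toContinuousLinearMap.contDiff.comp (contDiff_const.smul (contDiff_id.sub contDiff_const))

lemma isConformalMap_fderiv_scaledStereoInv (he : ‖e‖ = 1) (hJ : ∀ y, inner ℝ e (J y) = 0)
    (ht : t ≠ 0) (x : E) : IsConformalMap (fderiv ℝ (scaledStereoInv J e a t) x) := by
  have hne := linearIsometry_ne_pole he hJ (t⁻¹ • (x - a))
  have h1 : HasFDerivAt (fun x : E => J (t⁻¹ • (x - a)))
      (J.toContinuousLinearMap ∘SL (t⁻¹ • .id ℝ E)) x :=
    J.toContinuousLinearMap.hasFDerivAt.comp x (((hasFDerivAt_id x).sub_const a).const_smul t⁻¹)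
  have h2 := (hasFDerivAt_inversion (R := √2) hne).comp x h1
  have h3 : fderiv ℝ (scaledStereoInv J e a t) x = _ := h2.fderiv
  rw [h3]
  refine IsConformalMap.comp (IsConformalMap.smul ?_ ?_)
    (J.isConformalMap.comp (isConformalMap_const_smul (inv_ne_zero ht)))
  · exact LinearIsometry.isConformalMap (Submodule.reflection _).toLinearIsometry
  · exact pow_ne_zero 2 (div_ne_zero (by positivity) (dist_ne_zero.2 hne))

lemma scaledStereoInv_eq (he : ‖e‖ = 1) (hJ : ∀ y, inner ℝ e (J y) = 0) (ht : 0 < t) (x : E) :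
    scaledStereoInv J e a t x = (2 * t) • J ((‖x - a‖ ^ 2 + t ^ 2)⁻¹ • (x - a)) +
      (1 - 2 * (t ^ 2 / (‖x - a‖ ^ 2 + t ^ 2))) • e := by
  have hD : 0 < ‖x - a‖ ^ 2 + t ^ 2 := by positivity
  have hk : (√2 / dist (J (t⁻¹ • (x - a))) e) ^ 2 = 2 * (t ^ 2 / (‖x - a‖ ^ 2 + t ^ 2)) := by
    rw [div_pow, dist_sq_linearIsometry_pole he hJ, Real.sq_sqrt (by norm_num), norm_smul, mul_pow,
      Real.norm_eq_abs, sq_abs]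
    field_simp
  simp only [scaledStereoInv, inversion, hk, vsub_eq_sub, vadd_eq_add]
  simp only [map_smul]
  have h1 : 2 * (t ^ 2 / (‖x - a‖ ^ 2 + t ^ 2)) * t⁻¹ = 2 * t * (‖x - a‖ ^ 2 + t ^ 2)⁻¹ := by
    field_simp
  rw [smul_sub, smul_smul, h1, smul_smul, sub_smul, one_smul]
  abel

lemma norm_scaledStereoInv (he : ‖e‖ = 1) (hJ : ∀ y, inner ℝ e (J y) = 0) (x : E) :
    ‖scaledStereoInv J e a t x‖ = 1 := by
  set y := t⁻¹ • (x - a) with hy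
  have hD : (‖y‖ ^ 2 + 1) ≠ 0 := by positivity
  have hk : (√2 / dist (J y) e) ^ 2 = 2 / (‖y‖ ^ 2 + 1) := by
    rw [div_pow, dist_sq_linearIsometry_pole he hJ, Real.sq_sqrt (by norm_num)]
  rw [← sq_eq_sq₀ (norm_nonneg _) zero_le_one]
  simp only [scaledStereoInv, inversion, ← hy, hk, vsub_eq_sub, vadd_eq_add]
  rw [norm_add_sq_real, norm_smul, mul_pow, ← dist_eq_norm, dist_sq_linearIsometry_pole he hJ,
    real_inner_smul_left, inner_sub_left, real_inner_self_eq_norm_sq, real_inner_comm, hJ, he,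
    Real.norm_eq_abs, sq_abs]
  field_simp
  ring

end InverseStereographic

/-- Conformal barycenter: a nonzero finite measure without atoms carried by a compact set is
balanced by the inverse stereographic projection of a suitable similarity. -/
lemma exists_integral_scaledStereoInv_eq_zero {E G : Type*} [NormedAddCommGroup E]
    [InnerProductSpace ℝ E] [FiniteDimensional ℝ E] [MeasurableSpace E] [BorelSpace E]
    [NormedAddCommGroup G] [InnerProductSpace ℝ G] [CompleteSpace G] {J : E →ₗᵢ[ℝ] G} {e : G}
    (he : ‖e‖ = 1) (hJ : ∀ y, inner ℝ e (J y) = 0) {μ : Measure E} [IsFiniteMeasure μ] [NeZero μ]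
    {K : Set E} (hK : IsCompact K) (hμK : ∀ᵐ x ∂μ, x ∈ K) (hμ : ∀ x, μ {x} = 0) :
    ∃ a : E, ∃ t > 0, ∫ x, scaledStereoInv J e a t x ∂μ = 0 := by
  obtain ⟨p, hp⟩ := exists_forall_integral_halfSpaceBusemann_le hK hμK hμ
  obtain ⟨h1, h2⟩ := integral_eq_of_forall_integral_halfSpaceBusemann_le hK hμK hp
  have ht : 0 < Real.exp (p.2 / 2) := Real.exp_pos _
  refine ⟨p.1, Real.exp (p.2 / 2), ht, ?_⟩
  have hsq : Real.exp (p.2 / 2) ^ 2 = Real.exp p.2 := by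
    rw [← Real.exp_nat_mul]
    congr 1
    push_cast
    ring
  have hD (x : E) : ‖x - p.1‖ ^ 2 + Real.exp p.2 ≠ 0 := (norm_sub_sq_add_exp_pos p x).ne'
  have hinv : Continuous fun x : E => (‖x - p.1‖ ^ 2 + Real.exp p.2)⁻¹ :=
    Continuous.inv₀ (by fun_prop) hD
  have hi1 : Integrable (fun x : E => (‖x - p.1‖ ^ 2 + Real.exp p.2)⁻¹ • (x - p.1)) μ :=
    Continuous.integrable_of_ae_mem_isCompact hK hμK (by fun_prop)
  have hi2 : Integrable (fun x : E => Real.exp p.2 / (‖x - p.1‖ ^ 2 + Real.exp p.2)) μ :=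
    Continuous.integrable_of_ae_mem_isCompact hK hμK
      (by simp only [div_eq_mul_inv]; fun_prop)
  have hJi := J.toContinuousLinearMap.integral_comp_comm hi1
  have hJi' := J.toContinuousLinearMap.integrable_comp hi1
  simp only [LinearIsometry.coe_toContinuousLinearMap] at hJi hJi'
  simp only [scaledStereoInv_eq he hJ ht, hsq]
  have hi3 : Integrable
      (fun x : E => 1 - 2 * (Real.exp p.2 / (‖x - p.1‖ ^ 2 + Real.exp p.2))) μ :=
    (integrable_const 1).sub (hi2.const_mul 2)
  have hi4 := hJi'.smul (2 * Real.exp (p.2 / 2))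
  simp only [Pi.smul_def] at hi4
  rw [integral_add hi4 (hi3.smul_const e), integral_smul, hJi, h1,
    integral_smul_const, integral_sub (integrable_const 1) (hi2.const_mul 2), integral_const_mul,
    h2]
  simp
  ring_nf
  simp

/-- Balancing lemma: there is an injective smooth conformal map `F : ℝⁿ → Sⁿ ⊆ ℝ^{n+1}`
whose integral against `H^{n-1}` restricted to `∂Ω` vanishes. -/
theorem stmt2 {n : ℕ} (hn : 2 ≤ n) (Ω : Set (EuclideanSpace ℝ (Fin n)))
    (hΩo : IsOpen Ω) (hΩb : Bornology.IsBounded Ω) (hΩne : Ω.Nonempty)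
    (h0 : 0 < μH[(n : ℝ) - 1] (frontier Ω))
    (hfin : μH[(n : ℝ) - 1] (frontier Ω) < ⊤) :
    ∃ F : EuclideanSpace ℝ (Fin n) → EuclideanSpace ℝ (Fin (n + 1)),
      Function.Injective F ∧ ContDiff ℝ (⊤ : ℕ∞) F ∧
      (∀ x, ‖F x‖ = 1) ∧
      (∀ x, IsConformalMap (fderiv ℝ F x)) ∧
      (∫ x in frontier Ω, F x ∂(μH[(n : ℝ) - 1])) = 0 := by
  have hK : IsCompact (frontier Ω) :=
    Metric.isCompact_of_isClosed_isBounded isClosed_frontier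
      (hΩb.closure.subset frontier_subset_closure)
  have hd : 0 < (n : ℝ) - 1 := by
    have : (2 : ℝ) ≤ n := by exact_mod_cast hn
    linarith
  have : Fact (μH[(n : ℝ) - 1] (frontier Ω) < ⊤) := ⟨hfin⟩
  have : NeZero ((μH[(n : ℝ) - 1]).restrict (frontier Ω)) :=
    ⟨fun h => h0.ne' (Measure.restrict_eq_zero.1 h)⟩
  have hatom (x : EuclideanSpace ℝ (Fin n)) :
      (μH[(n : ℝ) - 1]).restrict (frontier Ω) {x} = 0 := by
    have := Measure.nullSingletonClass_hausdorff (EuclideanSpace ℝ (Fin n)) hd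
    exact measure_singleton x
  have : Fact (Module.finrank ℝ (EuclideanSpace ℝ (Fin (n + 1))) = n + 1) := ⟨by simp⟩
  set e : EuclideanSpace ℝ (Fin (n + 1)) := EuclideanSpace.single 0 1
  have he : ‖e‖ = 1 := by simp [e]
  have he0 : e ≠ 0 := norm_ne_zero_iff.1 (by simp [he])
  let J : EuclideanSpace ℝ (Fin n) →ₗᵢ[ℝ] EuclideanSpace ℝ (Fin (n + 1)) :=
    (Submodule.subtypeₗᵢ _).comp
      (OrthonormalBasis.fromOrthogonalSpanSingleton (𝕜 := ℝ) n he0).repr.symm.toLinearIsometry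
  have hJ (y : EuclideanSpace ℝ (Fin n)) : inner ℝ e (J y) = 0 :=
    Submodule.mem_orthogonal_singleton_iff_inner_right.1 (Subtype.property _)
  obtain ⟨a, t, ht, hzero⟩ := exists_integral_scaledStereoInv_eq_zero he hJ hK
    (ae_restrict_mem isClosed_frontier.measurableSet) hatom
  exact ⟨scaledStereoInv J e a t, scaledStereoInv_injective ht.ne',
    contDiff_scaledStereoInv he hJ, norm_scaledStereoInv he hJ,
    isConformalMap_fderiv_scaledStereoInv he hJ ht.ne', hzero⟩
end
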